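/- Assume char k = 0. Let W⁽¹⁾, …, W⁽ʳ⁾ be quantum generalized Weyl algebras over k (of degrees m₁, …, m_r ≥ 1) such that for each W⁽ʲ⁾ every q-parameter is a root of unity of multiplicative order at least 2, the orders of the q-parameters of W⁽ʲ⁾ are pairwise coprime, and every h-parameter of W⁽ʲ⁾ is nonconstant. Then the tensor product A = W⁽¹⁾ ⊗_k ⋯ ⊗_k W⁽ʳ⁾ is cancellative: for every associative unital k-algebra B, if the polynomial rings A[s] and B[s] are isomorphic as k-algebras, then A and B are isomorphic as k-algebras. -/

import Mathlib

/-- Generators of the degree `m` quantum generalized Weyl algebra: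
`x i`, `y i` for `i : Fin m`, and `t`. -/
inductive GWAGen (m : ℕ) : Type
  | x : Fin m → GWAGen m
  | y : Fin m → GWAGen m
  | t : GWAGen m

/-- The defining relations of the degree `m` quantum generalized Weyl algebra over `k`
with parameters `q : Fin m → k` and `h : Fin m → k[X]`:
`xᵢt = qᵢ·txᵢ`, `yᵢt = qᵢ⁻¹·tyᵢ`, `xᵢyᵢ = hᵢ(t)`, `yᵢxᵢ = hᵢ(qᵢ⁻¹t)`, and
`xᵢ`, `yᵢ` commute with `xⱼ`, `yⱼ` for `i ≠ j`. -/
inductive GWARel (k : Type*) [Field k] (m : ℕ) (q : Fin m → k) (h : Fin m → Polynomial k) :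
    FreeAlgebra k (GWAGen m) → FreeAlgebra k (GWAGen m) → Prop
  | xt (i : Fin m) : GWARel k m q h
      (FreeAlgebra.ι k (GWAGen.x i) * FreeAlgebra.ι k GWAGen.t)
      (q i • (FreeAlgebra.ι k GWAGen.t * FreeAlgebra.ι k (GWAGen.x i)))
  | yt (i : Fin m) : GWARel k m q h
      (FreeAlgebra.ι k (GWAGen.y i) * FreeAlgebra.ι k GWAGen.t)
      ((q i)⁻¹ • (FreeAlgebra.ι k GWAGen.t * FreeAlgebra.ι k (GWAGen.y i)))
  | xy (i : Fin m) : GWARel k m q h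
      (FreeAlgebra.ι k (GWAGen.x i) * FreeAlgebra.ι k (GWAGen.y i))
      (Polynomial.aeval (FreeAlgebra.ι k GWAGen.t) (h i))
  | yx (i : Fin m) : GWARel k m q h
      (FreeAlgebra.ι k (GWAGen.y i) * FreeAlgebra.ι k (GWAGen.x i))
      (Polynomial.aeval ((q i)⁻¹ • FreeAlgebra.ι k GWAGen.t) (h i))
  | xx (i j : Fin m) (hij : i ≠ j) : GWARel k m q h
      (FreeAlgebra.ι k (GWAGen.x i) * FreeAlgebra.ι k (GWAGen.x j))
      (FreeAlgebra.ι k (GWAGen.x j) * FreeAlgebra.ι k (GWAGen.x i))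
  | yy (i j : Fin m) (hij : i ≠ j) : GWARel k m q h
      (FreeAlgebra.ι k (GWAGen.y i) * FreeAlgebra.ι k (GWAGen.y j))
      (FreeAlgebra.ι k (GWAGen.y j) * FreeAlgebra.ι k (GWAGen.y i))
  | xyc (i j : Fin m) (hij : i ≠ j) : GWARel k m q h
      (FreeAlgebra.ι k (GWAGen.x i) * FreeAlgebra.ι k (GWAGen.y j))
      (FreeAlgebra.ι k (GWAGen.y j) * FreeAlgebra.ι k (GWAGen.x i))

/-- The degree `m` quantum generalized Weyl algebra `k[t](x, y, σ, h)` with `σᵢ(t) = qᵢt`: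
the quotient of the free algebra on the generators by the two-sided ideal generated by
the defining relations. -/
abbrev GWA (k : Type*) [Field k] (m : ℕ) (q : Fin m → k) (h : Fin m → Polynomial k) : Type _ :=
  RingQuot (GWARel k m q h)

variable {k : Type*} [Field k] {m : ℕ} {q : Fin m → k} {h : Fin m → Polynomial k}

/-- The generator `xᵢ` of the quantum GWA. -/
noncomputable def GWA.x (i : Fin m) : GWA k m q h :=
  RingQuot.mkAlgHom k (GWARel k m q h) (FreeAlgebra.ι k (GWAGen.x i))

/-- The generator `yᵢ` of the quantum GWA. -/
noncomputable def GWA.y (i : Fin m) : GWA k m q h :=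
  RingQuot.mkAlgHom k (GWARel k m q h) (FreeAlgebra.ι k (GWAGen.y i))

/-- The generator `t` of the quantum GWA. -/
noncomputable def GWA.t : GWA k m q h :=
  RingQuot.mkAlgHom k (GWARel k m q h) (FreeAlgebra.ι k GWAGen.t)

/-- The quantum GWA is an algebra over its center. -/
noncomputable instance GWA.algebraCenter :
    Algebra (Subalgebra.center k (GWA k m q h)) (GWA k m q h) :=
  RingHom.toAlgebra' (Subalgebra.center k (GWA k m q h)).val.toRingHom
    (fun c x => by
      have := Subalgebra.mem_center_iff.mp c.2 x
      simpa using this.symm)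

open scoped TensorProduct

open Polynomial

namespace QuantumGWA

/-- The words `xˡ` (for `l ≥ 0`) and `y⁻ˡ` (for `l < 0`). -/
def zword {R : Type*} [Monoid R] (x y : R) : ℤ → R
  | .ofNat n => x ^ n
  | .negSucc n => y ^ (n + 1)

section Normalizing

variable {Λ R : Type*} [CommRing Λ] [Ring R] [Algebra Λ R]

/-- The elements of the form `s * zword x y l` with `s ∈ S`. -/
def gradedPiece (S : Subalgebra Λ R) (x y : R) (l : ℤ) : Submodule Λ R :=
  (Subalgebra.toSubmodule S).map (LinearMap.mulRight Λ (zword x y l))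

theorem mem_gradedPiece {S : Subalgebra Λ R} {x y : R} {l : ℤ} {r : R} :
    r ∈ gradedPiece S x y l ↔ ∃ s ∈ S, s * zword x y l = r := by
  simp [gradedPiece, Submodule.mem_map]

theorem normalizes_adjoin {x : R} {G : Set R}
    (hx : ∀ g ∈ G, ∃ s ∈ Algebra.adjoin Λ G, x * g = s * x) :
    ∀ s ∈ Algebra.adjoin Λ G, ∃ s' ∈ Algebra.adjoin Λ G, x * s = s' * x := by
  intro s hs
  induction hs using Algebra.adjoin_induction with
  | mem g hg => exact hx g hg
  | algebraMap c => exact ⟨_, Subalgebra.algebraMap_mem _ c, (Algebra.commutes c x).symm⟩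
  | add a b _ _ ha hb =>
    obtain ⟨a', ha', ea⟩ := ha
    obtain ⟨b', hb', eb⟩ := hb
    exact ⟨a' + b', add_mem ha' hb', by rw [mul_add, ea, eb, add_mul]⟩
  | mul a b _ _ ha hb =>
    obtain ⟨a', ha', ea⟩ := ha
    obtain ⟨b', hb', eb⟩ := hb
    exact ⟨a' * b', mul_mem ha' hb', by rw [← mul_assoc, ea, mul_assoc, eb, mul_assoc]⟩

theorem normalizes_pow {S : Set R} {x : R} (hx : ∀ s ∈ S, ∃ s' ∈ S, x * s = s' * x) (n : ℕ) :
    ∀ s ∈ S, ∃ s' ∈ S, x ^ n * s = s' * x ^ n := by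
  induction n with
  | zero => intro s hs; exact ⟨s, hs, by simp⟩
  | succ n ih =>
    intro s hs
    obtain ⟨a, ha, ea⟩ := hx s hs
    obtain ⟨b, hb, eb⟩ := ih a ha
    exact ⟨b, hb, by rw [pow_succ, mul_assoc, ea, ← mul_assoc, eb, mul_assoc]⟩

theorem exists_mul_pow_eq {M : Type*} [Monoid M] {S : Submonoid M} {x : M}
    (hx : ∀ s ∈ S, ∃ s' ∈ S, x * s = s' * x) {s : M} (hs : s ∈ S) (n : ℕ) :
    ∃ s' ∈ S, (s * x) ^ n = s' * x ^ n := by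
  induction n with
  | zero => exact ⟨1, one_mem _, by simp⟩
  | succ n ih =>
    obtain ⟨a, ha, ea⟩ := ih
    obtain ⟨b, hb, eb⟩ := hx a ha
    refine ⟨s * b, mul_mem hs hb, ?_⟩
    rw [pow_succ', ea, mul_assoc, ← mul_assoc x, eb, pow_succ' x]
    simp only [mul_assoc]

variable {S : Subalgebra Λ R} {x y : R}
  (hx : ∀ s ∈ S, ∃ s' ∈ S, x * s = s' * x) (hy : ∀ s ∈ S, ∃ s' ∈ S, y * s = s' * y)
  (hxy : x * y ∈ S) (hyx : y * x ∈ S)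

include hx hxy in
theorem left_mul_mem_iSup_gradedPiece {r : R} (hr : r ∈ ⨆ l, gradedPiece S x y l) :
    x * r ∈ ⨆ l, gradedPiece S x y l := by
  induction hr using Submodule.iSup_induction' with
  | zero => simp
  | add a b _ _ ha hb => rw [mul_add]; exact add_mem ha hb
  | mem l r hr =>
    obtain ⟨s, hs, rfl⟩ := mem_gradedPiece.mp hr
    obtain ⟨s', hs', e⟩ := hx s hs
    rw [← mul_assoc, e]
    rcases l with n | n
    · refine Submodule.mem_iSup_of_mem (Int.ofNat (n + 1)) (mem_gradedPiece.mpr ⟨s', hs', ?_⟩)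
      simp only [zword]
      rw [pow_succ', mul_assoc]
    · rcases n with - | n
      · refine Submodule.mem_iSup_of_mem (Int.ofNat 0)
          (mem_gradedPiece.mpr ⟨s' * (x * y), mul_mem hs' hxy, ?_⟩)
        simp [zword, mul_assoc]
      · refine Submodule.mem_iSup_of_mem (Int.negSucc n)
          (mem_gradedPiece.mpr ⟨s' * (x * y), mul_mem hs' hxy, ?_⟩)
        simp only [zword]
        rw [pow_succ' y (n + 1)]; simp only [mul_assoc]

include hy hyx in
theorem left_mul_mem_iSup_gradedPiece' {r : R} (hr : r ∈ ⨆ l, gradedPiece S x y l) :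
    y * r ∈ ⨆ l, gradedPiece S x y l := by
  induction hr using Submodule.iSup_induction' with
  | zero => simp
  | add a b _ _ ha hb => rw [mul_add]; exact add_mem ha hb
  | mem l r hr =>
    obtain ⟨s, hs, rfl⟩ := mem_gradedPiece.mp hr
    obtain ⟨s', hs', e⟩ := hy s hs
    rw [← mul_assoc, e]
    rcases l with n | n
    · rcases n with - | n
      · refine Submodule.mem_iSup_of_mem (Int.negSucc 0) (mem_gradedPiece.mpr ⟨s', hs', ?_⟩)
        simp [zword]
      · refine Submodule.mem_iSup_of_mem (Int.ofNat n)
          (mem_gradedPiece.mpr ⟨s' * (y * x), mul_mem hs' hyx, ?_⟩)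
        simp only [zword]
        rw [pow_succ' x n]; simp only [mul_assoc]
    · refine Submodule.mem_iSup_of_mem (Int.negSucc (n + 1)) (mem_gradedPiece.mpr ⟨s', hs', ?_⟩)
      simp only [zword]
      rw [pow_succ' y (n + 1), mul_assoc]

include hx hy hxy hyx in
theorem adjoin_le_iSup_gradedPiece {G : Set R} (hG : G ⊆ insert x (insert y (S : Set R)))
    {r : R} (hr : r ∈ Algebra.adjoin Λ G) : r ∈ ⨆ l, gradedPiece S x y l := by
  suffices H : ∀ w ∈ ⨆ l, gradedPiece S x y l, r * w ∈ ⨆ l, gradedPiece S x y l by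
    have h1 : (1 : R) ∈ ⨆ l, gradedPiece S x y l :=
      Submodule.mem_iSup_of_mem (Int.ofNat 0)
        (mem_gradedPiece.mpr ⟨1, one_mem _, by simp [zword]⟩)
    simpa using H 1 h1
  have HS : ∀ s ∈ S, ∀ w ∈ ⨆ l, gradedPiece S x y l, s * w ∈ ⨆ l, gradedPiece S x y l := by
    intro s hs w hw
    induction hw using Submodule.iSup_induction' with
    | zero => simp
    | add a b _ _ ha hb => rw [mul_add]; exact add_mem ha hb
    | mem l r hr =>
      obtain ⟨a, ha, rfl⟩ := mem_gradedPiece.mp hr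
      exact Submodule.mem_iSup_of_mem l
        (mem_gradedPiece.mpr ⟨s * a, mul_mem hs ha, by rw [mul_assoc]⟩)
  induction hr using Algebra.adjoin_induction with
  | mem g hg =>
    rcases hG hg with rfl | rfl | hg
    · exact fun w hw => left_mul_mem_iSup_gradedPiece hx hxy hw
    · exact fun w hw => left_mul_mem_iSup_gradedPiece' hy hyx hw
    · exact HS g hg
  | algebraMap c => exact HS _ (S.algebraMap_mem c)
  | add a b _ _ ha hb =>
    intro w hw
    rw [add_mul]; exact add_mem (ha w hw) (hb w hw)
  | mul a b _ _ ha hb =>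
    intro w hw
    rw [mul_assoc]; exact ha _ (hb w hw)

include hx hy hxy hyx in
theorem fg_adjoin_insert_insert (hS : (Subalgebra.toSubmodule S).FG) {n : ℕ} (hn : 0 < n)
    (hxn : x ^ n ∈ Set.range (algebraMap Λ R)) (hyn : y ^ n ∈ Set.range (algebraMap Λ R))
    {G : Set R} (hG : Algebra.adjoin Λ G = S) :
    (Subalgebra.toSubmodule (Algebra.adjoin Λ (insert x (insert y G)))).FG := by
  have hred : ∀ z : R, z ^ n ∈ Set.range (algebraMap Λ R) → ∀ m : ℕ,
      ∃ c : Λ, z ^ m = c • z ^ (m % n) := by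
    rintro z ⟨c, hc⟩ m
    refine ⟨c ^ (m / n), ?_⟩
    rw [Algebra.smul_def, map_pow, hc, ← pow_mul, ← pow_add, Nat.div_add_mod]
  let D : Set R := (fun i => x ^ i) '' (Set.Iio n) ∪ (fun i => y ^ i) '' (Set.Iio n)
  have hD : D.Finite := ((Set.finite_Iio n).image _).union ((Set.finite_Iio n).image _)
  have hGS : G ⊆ S := hG ▸ Algebra.subset_adjoin
  have key : Subalgebra.toSubmodule (Algebra.adjoin Λ (insert x (insert y G))) =
      Subalgebra.toSubmodule S * Submodule.span Λ D := by
    apply le_antisymm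
    · intro r hr
      have h1 := adjoin_le_iSup_gradedPiece hx hy hxy hyx
        (Set.insert_subset_insert (Set.insert_subset_insert hGS)) hr
      refine (iSup_le fun l => ?_ : (⨆ l, gradedPiece S x y l) ≤ _) h1
      intro r hr
      obtain ⟨s, hs, rfl⟩ := mem_gradedPiece.mp hr
      refine Submodule.mul_mem_mul hs ?_
      rcases l with m | m
      · obtain ⟨c, hc⟩ := hred x hxn m
        simp only [zword]
        rw [hc]
        exact Submodule.smul_mem _ _ (Submodule.subset_span
          (Or.inl ⟨_, Nat.mod_lt _ hn, rfl⟩))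
      · obtain ⟨c, hc⟩ := hred y hyn (m + 1)
        simp only [zword]
        rw [hc]
        exact Submodule.smul_mem _ _ (Submodule.subset_span
          (Or.inr ⟨_, Nat.mod_lt _ hn, rfl⟩))
    · rw [Submodule.mul_le]
      intro s hs d hd
      have hx' : x ∈ Algebra.adjoin Λ (insert x (insert y G)) := Algebra.subset_adjoin (by simp)
      have hy' : y ∈ Algebra.adjoin Λ (insert x (insert y G)) := Algebra.subset_adjoin (by simp)
      refine mul_mem (S := Subalgebra Λ R) (s := Algebra.adjoin Λ (insert x (insert y G))) ?_ ?_
      · have : S ≤ Algebra.adjoin Λ (insert x (insert y G)) := by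
          rw [← hG]
          exact Algebra.adjoin_mono ((Set.subset_insert _ _).trans (Set.subset_insert _ _))
        exact this hs
      · have : Submodule.span Λ D ≤
            Subalgebra.toSubmodule (Algebra.adjoin Λ (insert x (insert y G))) := by
          rw [Submodule.span_le]
          rintro _ (⟨i, -, rfl⟩ | ⟨i, -, rfl⟩)
          · exact pow_mem hx' i
          · exact pow_mem hy' i
        exact this hd
  rw [key]
  exact hS.mul (Submodule.fg_span hD)

end Normalizing

section Representations

universe u

open TensorProduct in
theorem exists_span_range_eq_top {Z K B : Type*} [CommRing Z] [Field K] [IsAlgClosed K]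
    [Algebra Z K] [Ring B] [Algebra Z B] [Module.Finite Z B] [Nontrivial (K ⊗[Z] B)] :
    ∃ (d : ℕ) (_ : NeZero d) (ρ : B →ₐ[Z] Matrix (Fin d) (Fin d) K),
      Submodule.span K (Set.range ρ) = ⊤ := by
  let S := K ⊗[Z] B
  have : IsArtinianRing S := IsArtinianRing.of_finite K S
  let Q := S ⧸ Ring.jacobson S
  have : Nontrivial Q := Ideal.Quotient.nontrivial_iff.mpr (Ring.jacobson_lt_top S).ne
  have : FiniteDimensional K Q :=
    Module.Finite.of_surjective (Ideal.Quotient.mkₐ K (Ring.jacobson S)).toLinearMap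
      Ideal.Quotient.mk_surjective
  obtain ⟨n, d, hd, ⟨e⟩⟩ := IsSemisimpleRing.exists_algEquiv_pi_matrix_of_isAlgClosed K Q
  have hn : 0 < n := by
    rcases Nat.eq_zero_or_pos n with rfl | h
    · exact absurd e.toEquiv.subsingleton (not_subsingleton Q)
    · exact h
  let π : S →ₐ[K] Matrix (Fin (d ⟨0, hn⟩)) (Fin (d ⟨0, hn⟩)) K :=
    ((Pi.evalAlgHom K _ (⟨0, hn⟩ : Fin n)).comp e.toAlgHom).comp
      (Ideal.Quotient.mkₐ K (Ring.jacobson S))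
  have hπ : Function.Surjective π :=
    ((Function.surjective_eval (⟨0, hn⟩ : Fin n)).comp e.surjective).comp
      Ideal.Quotient.mk_surjective
  refine ⟨d ⟨0, hn⟩, hd _, (π.restrictScalars Z).comp Algebra.TensorProduct.includeRight, ?_⟩
  rw [eq_top_iff]
  intro M _
  obtain ⟨s, rfl⟩ := hπ M
  induction s using TensorProduct.induction_on with
  | zero => simp
  | add a b ha hb => rw [map_add]; exact add_mem (ha trivial) (hb trivial)
  | tmul a b =>
    have : (a ⊗ₜ[Z] b : S) = a • (1 ⊗ₜ[Z] b) := by simp [TensorProduct.smul_tmul']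
    rw [this, map_smul]
    exact Submodule.smul_mem _ _ (Submodule.subset_span ⟨b, rfl⟩)

theorem nontrivial_tensorProduct_of_field {Z κ K B : Type*} [CommRing Z] [Field κ] [Field K]
    [Algebra Z κ] [Algebra κ K] [Algebra Z K] [IsScalarTower Z κ K] [AddCommGroup B] [Module Z B]
    [Nontrivial (TensorProduct Z κ B)] : Nontrivial (TensorProduct Z K B) :=
  (TensorProduct.AlgebraTensorModule.cancelBaseChange Z κ κ K B).symm.toEquiv.nontrivial

theorem exists_algebra_isAlgClosed {Z : Type u} {B : Type*} [CommRing Z] [Ring B] [Algebra Z B]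
    [Module.Finite Z B] (hinj : Function.Injective (algebraMap Z B)) {c : Z}
    (hc : ¬ IsNilpotent c) :
    ∃ (K : Type u) (_ : Field K) (_ : IsAlgClosed K) (_ : Algebra Z K) (d : ℕ) (_ : NeZero d)
      (ρ : B →ₐ[Z] Matrix (Fin d) (Fin d) K),
      Submodule.span K (Set.range ρ) = ⊤ ∧ ρ (algebraMap Z B c) ≠ 0 := by
  obtain ⟨p, hp, hcp⟩ : ∃ p : Ideal Z, p.IsPrime ∧ c ∉ p := by
    by_contra! H
    exact hc (by
      rw [← mem_nilradical, nilradical_eq_sInf, Ideal.mem_sInf]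
      exact fun {I} hI => H I hI)
  have hsupp : (⟨p, hp⟩ : PrimeSpectrum Z) ∈ Module.support Z B := by
    rw [Module.support_eq_zeroLocus, PrimeSpectrum.mem_zeroLocus]
    intro a ha
    have : a = 0 := hinj (by
      have := Module.mem_annihilator.mp ha (1 : B)
      rw [Algebra.smul_def, mul_one] at this
      simpa using this)
    simp [this]
  have h1 := (Module.mem_support_iff_nontrivial_residueField_tensorProduct _).mp hsupp
  let κ := p.ResidueField
  let K := AlgebraicClosure κ
  have : Nontrivial (TensorProduct Z κ B) := h1
  have : Nontrivial (TensorProduct Z K B) := nontrivial_tensorProduct_of_field (κ := κ)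
  obtain ⟨d, hd, ρ, hρ⟩ := exists_span_range_eq_top (Z := Z) (K := K) (B := B)
  refine ⟨K, inferInstance, inferInstance, inferInstance, d, hd, ρ, hρ, ?_⟩
  rw [AlgHom.commutes, IsScalarTower.algebraMap_apply Z K]
  intro h
  have h2 : algebraMap Z K c = 0 := by
    have := FaithfulSMul.algebraMap_injective K (Matrix (Fin d) (Fin d) K)
    exact this (by simpa using h)
  rw [IsScalarTower.algebraMap_apply Z κ K] at h2
  have h3 : algebraMap Z κ c = 0 := by simpa using h2
  exact hcp (Ideal.algebraMap_residueField_eq_zero.mp h3)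

end Representations

section Represents

/-- The coefficients of `z` act as the scalars given by the coefficients of `f`. -/
def Represents {k B E n : Type*} [Field k] [Ring B] [Algebra k B] [CommRing E] [Algebra k E]
    [Fintype n] [DecidableEq n] (ρ : B →ₐ[k] Matrix n n E) (z : B[X]) (f : E[X]) : Prop :=
  ∀ i, ρ (z.coeff i) = Matrix.scalar n (f.coeff i)

variable {k B E n : Type*} [Field k] [Ring B] [Algebra k B] [CommRing E] [Algebra k E]
  [Fintype n] [DecidableEq n] {ρ : B →ₐ[k] Matrix n n E}

theorem commute_coeff {z : B[X]} (hz : ∀ r, Commute z r) (i : ℕ) (b : B) :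
    Commute (z.coeff i) b := by
  have : (z * C b).coeff i = (C b * z).coeff i := by rw [(hz (C b)).eq]
  rwa [coeff_mul_C, coeff_C_mul] at this

theorem exists_represents (hρ : ∀ c, (∀ b, Commute c b) → ∃ a, ρ c = Matrix.scalar n a) {z : B[X]}
    (hz : ∀ r, Commute z r) : ∃ f : E[X], Represents ρ z f := by
  choose a ha using fun i => hρ _ (commute_coeff hz i)
  refine ⟨∑ i ∈ Finset.range (z.natDegree + 1), C (a i) * X ^ i, fun i => ?_⟩
  rw [finsetSum_coeff]
  simp only [coeff_C_mul, coeff_X_pow, mul_ite, mul_one, mul_zero, Finset.sum_ite_eq,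
    Finset.mem_range]
  split_ifs with h
  · exact ha i
  · rw [coeff_eq_zero_of_natDegree_lt (by omega)]; simp

theorem Represents.map_eq {σ : B[X] →ₐ[k] Matrix n n E} {u : E} (hu : σ X = Matrix.scalar n u)
    {z : B[X]} {f : E[X]} (hf : Represents (σ.comp CAlgHom) z f) :
    σ z = Matrix.scalar n (eval u f) := by
  set N := max z.natDegree f.natDegree + 1
  have e1 : z = ∑ i ∈ Finset.range N, C (z.coeff i) * X ^ i :=
    (as_sum_range_C_mul_X_pow' z (by omega))
  rw [eval_eq_sum_range' (by omega : f.natDegree < N)]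
  conv_lhs => rw [e1]
  rw [map_sum, map_sum]
  refine Finset.sum_congr rfl fun i _ => ?_
  have := hf i
  rw [AlgHom.comp_apply, CAlgHom_apply] at this
  rw [map_mul, map_pow, hu, this, map_mul, map_pow]

end Represents

section Specialization

universe u v

/-- Central elements that are not nilpotent are detected by absolutely irreducible
finite-dimensional representations. -/
def SeparatesCenter (k : Type v) (B : Type u) [Field k] [Ring B] [Algebra k B] : Prop :=
  ∀ c : B, (∀ b, Commute c b) → ¬ IsNilpotent c →
    ∃ (K : Type u) (_ : Field K) (_ : IsAlgClosed K) (_ : Algebra k K) (d : ℕ) (_ : NeZero d)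
      (ρ : B →ₐ[k] Matrix (Fin d) (Fin d) K), Submodule.span K (Set.range ρ) = ⊤ ∧ ρ c ≠ 0

theorem separatesCenter_of_finite {k : Type v} {Z B : Type u} [Field k] [CommRing Z] [Ring B]
    [Algebra k Z] [Algebra k B] [Algebra Z B] [IsScalarTower k Z B] [Module.Finite Z B]
    (hinj : Function.Injective (algebraMap Z B))
    (hZ : ∀ c : B, (∀ b, Commute c b) → c ∈ Set.range (algebraMap Z B)) :
    SeparatesCenter k B := by
  intro c hc hnil
  obtain ⟨z, rfl⟩ := hZ c hc
  obtain ⟨K, _, _, _, d, _, ρ, hρ, hρc⟩ :=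
    exists_algebra_isAlgClosed hinj (c := z) (fun h => hnil (h.map (algebraMap Z B)))
  let _ : Algebra k K := ((algebraMap Z K).comp (algebraMap k Z)).toAlgebra
  have : IsScalarTower k Z K := IsScalarTower.of_algebraMap_eq fun _ => rfl
  exact ⟨K, inferInstance, inferInstance, inferInstance, d, inferInstance,
    ρ.restrictScalars k, hρ, hρc⟩

variable {k B K E F : Type*} [Field k] [Ring B] [Algebra k B] [Field K] [Algebra k K]
  [CommRing E] [Algebra k E] [CommRing F] [Algebra k F] {n : Type*} [Fintype n] [DecidableEq n]

/-- The extension of a matrix representation of `B` to `B[X]` sending `X` to the scalar `u`. -/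
noncomputable def specialize (ρ : B →ₐ[k] Matrix n n K) (φ : K →ₐ[k] E) (u : E) :
    B[X] →ₐ[k] Matrix n n E :=
  eval₂AlgHom (φ.mapMatrix.comp ρ) (Matrix.scalar n u)
    (fun _ => (Matrix.scalar_commute u (fun _ => Commute.all _ _) _).symm)

variable (ρ : B →ₐ[k] Matrix n n K) (φ : K →ₐ[k] E) (u : E)

@[simp]
theorem specialize_C (b : B) : specialize ρ φ u (C b) = φ.mapMatrix (ρ b) := by
  simp [specialize]

@[simp]
theorem specialize_X : specialize ρ φ u X = Matrix.scalar n u := by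
  simp [specialize]

theorem mapMatrix_specialize (ψ : E →ₐ[k] F) (r : B[X]) :
    ψ.mapMatrix (specialize ρ φ u r) = specialize ρ (ψ.comp φ) (ψ u) r := by
  have : (ψ.mapMatrix.comp (specialize ρ φ u)) = specialize ρ (ψ.comp φ) (ψ u) := by
    apply Polynomial.algHom_ext'
    · ext b i j
      simp
    · ext i j
      simp [Matrix.diagonal_apply, apply_ite ψ]
  exact DFunLike.congr_fun this r

theorem exists_eq_scalar_of_commute (hρ : Submodule.span K (Set.range ρ) = ⊤) {M : Matrix n n E}
    (hM : ∀ b, Commute M (φ.mapMatrix (ρ b))) : ∃ e, M = Matrix.scalar n e := by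
  have key : ∀ N : Matrix n n K, Commute M (φ.mapMatrix N) := by
    intro N
    have hN : N ∈ Submodule.span K (Set.range ρ) := hρ ▸ Submodule.mem_top
    induction hN using Submodule.span_induction with
    | mem x hx => obtain ⟨b, rfl⟩ := hx; exact hM b
    | zero => simp
    | add x y _ _ hx hy => rw [map_add]; exact hx.add_right hy
    | smul a x _ hx =>
      have : φ.mapMatrix (a • x) = φ a • φ.mapMatrix x := by ext i j; simp
      rw [this]
      exact hx.smul_right _
  obtain ⟨e, he⟩ := Matrix.mem_range_scalar_of_commute_single (M := M) (fun i j _ => by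
    have := key (Matrix.single i j 1)
    rw [AlgHom.mapMatrix_apply, Matrix.map_single _ _ _ φ, map_one] at this
    exact this.symm)
  exact ⟨e, he.symm⟩

theorem exists_polynomial_of_central (hρ : Submodule.span K (Set.range ρ) = ⊤) {z : B[X]}
    (hz : ∀ r, Commute z r) : ∃ f : K[X], Represents ρ z f :=
  exists_represents (fun _ hc => exists_eq_scalar_of_commute ρ (AlgHom.id k K) hρ
    fun b => by simpa using (hc b).map ρ) hz

theorem specialize_eq_scalar {z : B[X]} {f : K[X]} (hf : Represents ρ z f) :
    specialize ρ φ u z = Matrix.scalar n (eval₂ φ.toRingHom u f) := by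
  rw [← eval_map]
  refine Represents.map_eq (specialize_X ρ φ u) fun i => ?_
  rw [AlgHom.comp_apply, CAlgHom_apply, specialize_C, hf, coeff_map]
  ext a b
  simp [Matrix.diagonal_apply, apply_ite φ]

end Specialization

section NormalElement

universe u v

theorem eq_zero_of_normal_of_pow_eq_zero {K n : Type*} [Field K] [Fintype n] [DecidableEq n]
    {τ : Matrix n n K} (hτ : ∀ M, ∃ M', τ * M = M' * τ) {N : ℕ} (hN : τ ^ N = 0) : τ = 0 := by
  rw [Matrix.ext_iff_trace_mul_left]
  intro M
  obtain ⟨s, -, hs⟩ := exists_mul_pow_eq (S := (⊤ : Submonoid (Matrix n n K))) (x := τ)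
    (fun M _ => (hτ M).imp fun _ h => ⟨trivial, h⟩) (s := M) trivial N
  have h1 : IsNilpotent (M * τ) := ⟨N, by rw [hs, hN, mul_zero]⟩
  simpa using (Matrix.isNilpotent_trace_of_isNilpotent h1).eq_zero

theorem exists_eq_scalar_of_eval_centralizer {K n : Type*} [Field K] [Fintype n] [DecidableEq n]
    {τ : Matrix n n K[X]} (a : K)
    (hτ : ∀ M : Matrix n n K, ∃ v : Matrix n n K[X], Commute v τ ∧ v.map (eval a) = M) :
    ∃ g, τ = Matrix.scalar n g := by
  have step : ∀ M : Matrix n n K[X], ∃ M' : Matrix n n K[X],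
      M * τ - τ * M = (X - C a) • (M' * τ - τ * M') := by
    intro M
    obtain ⟨v, hv, e⟩ := hτ (M.map (eval a))
    have h1 : ∀ i j, ∃ w, M i j - v i j = (X - C a) * w := by
      intro i j
      refine dvd_iff_isRoot.mpr ?_
      have := congrFun (congrFun e i) j
      simp only [Matrix.map_apply] at this
      simp [IsRoot, this]
    choose w hw using h1
    have h2 : M = v + (X - C a) • Matrix.of w := by
      ext1 i j
      simp [← hw]
    refine ⟨Matrix.of w, ?_⟩
    rw [h2, add_mul, mul_add, hv.eq, smul_mul_assoc, mul_smul_comm, smul_sub]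
    abel
  have steps : ∀ (l : ℕ) (M : Matrix n n K[X]), ∃ M' : Matrix n n K[X],
      M * τ - τ * M = (X - C a) ^ l • (M' * τ - τ * M') := by
    intro l
    induction l with
    | zero => exact fun M => ⟨M, by simp⟩
    | succ l ih =>
      intro M
      obtain ⟨M', h'⟩ := ih M
      obtain ⟨M'', h''⟩ := step M'
      exact ⟨M'', by rw [h', h'', smul_smul, pow_succ]⟩
  have hcomm : ∀ M : Matrix n n K[X], M * τ - τ * M = 0 := by
    intro M
    ext1 i j
    have hdvd : ∀ l, (X - C a) ^ l ∣ (M * τ - τ * M) i j := by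
      intro l
      obtain ⟨M', h'⟩ := steps l M
      rw [h', Matrix.smul_apply, smul_eq_mul]
      exact dvd_mul_right _ _
    rw [Matrix.zero_apply]
    refine eq_zero_of_dvd_of_natDegree_lt (hdvd (((M * τ - τ * M) i j).natDegree + 1)) ?_
    rw [natDegree_pow, natDegree_X_sub_C, mul_one]
    exact Nat.lt_succ_self _
  obtain ⟨g, hg⟩ := Matrix.mem_range_scalar_of_commute_single (M := τ)
    (fun i j _ => sub_eq_zero.mp (hcomm _))
  exact ⟨g, hg.symm⟩

theorem isNilpotent_coeff_of_normal {k : Type v} {B : Type u} [Field k] [Ring B] [Algebra k B]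
    (hB : SeparatesCenter k B) {D : Set B[X]} (hD : Algebra.adjoin k D = ⊤) {t x y : B[X]}
    (ht : ∀ g ∈ D, ∃ c : k, t * g = c • (g * t)) {q : k} (hq : q ≠ 1)
    (hx : x * t = q • (t * x)) {h : k[X]} (hh : h ≠ 0) (hxy : x * y = aeval t h)
    {N : ℕ} (hT : ∀ r, Commute (t ^ N) r)
    (hcomm : ∀ (E : Type u) [Ring E] [Algebra k E] (ρ : B[X] →ₐ[k] E), ρ t = 0 →
      ∀ g ∈ D, Commute g t ∨ ∀ r, Commute (ρ g) (ρ r)) {i : ℕ} (hi : i ≠ 0) :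
    IsNilpotent ((t ^ N).coeff i) := by
  by_contra hnil
  obtain ⟨K, _, _, _, d, _, ρ, hρ, hρc⟩ := hB _ (commute_coeff hT i) hnil
  obtain ⟨f, hf⟩ := exists_polynomial_of_central ρ hρ hT
  have hfi : f.coeff i ≠ 0 := fun h0 => hρc (by rw [hf, h0, map_zero])
  have hfd : f.natDegree ≠ 0 := fun h0 => hfi (coeff_eq_zero_of_natDegree_lt (by omega))
  obtain ⟨a, ha⟩ := IsAlgClosed.exists_root f (fun h0 => hfd (natDegree_eq_of_degree_eq_some h0))
  set ρa := specialize ρ (AlgHom.id k K) a with hρa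
  set ρX := specialize ρ (CAlgHom : K →ₐ[k] K[X]) X with hρX
  have heval : ∀ r, (ρX r).map (eval a) = ρa r := by
    intro r
    have := mapMatrix_specialize ρ (CAlgHom : K →ₐ[k] K[X]) X ((aeval a).restrictScalars k) r
    have e : (((aeval a : K[X] →ₐ[K] K).restrictScalars k).comp (CAlgHom : K →ₐ[k] K[X])) =
        AlgHom.id k K := by
      ext b; simp
    rw [e] at this
    simpa [coe_aeval_eq_eval] using this
  have hspan : ∀ P : Matrix (Fin d) (Fin d) K → Prop, (∀ r, P (ρa r)) → P 0 →
      (∀ M M', P M → P M' → P (M + M')) → (∀ (b : K) M, P M → P (b • M)) → ∀ M, P M := by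
    intro P h1 h2 h3 h4 M
    have hM : M ∈ Submodule.span K (Set.range ρ) := hρ ▸ Submodule.mem_top
    induction hM using Submodule.span_induction with
    | mem x hx =>
      obtain ⟨b, rfl⟩ := hx
      have := h1 (C b)
      rw [hρa, specialize_C] at this
      simpa using this
    | zero => exact h2
    | add x y _ _ hx hy => exact h3 _ _ hx hy
    | smul b x _ hx => exact h4 _ _ hx
  have hτ0 : ρa t = 0 := by
    refine eq_zero_of_normal_of_pow_eq_zero (N := N) ?_ ?_
    · apply hspan
      · intro r
        have : ∃ r', t * r = r' * t := by
          have hr : r ∈ Algebra.adjoin k D := hD ▸ Algebra.mem_top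
          obtain ⟨s, -, hs⟩ := normalizes_adjoin (x := t) (fun g hg => by
            obtain ⟨c, hc⟩ := ht g hg
            exact ⟨c • g, Subalgebra.smul_mem _ (Algebra.subset_adjoin hg) c,
              by rw [hc, smul_mul_assoc]⟩) r hr
          exact ⟨s, hs⟩
        obtain ⟨r', e⟩ := this
        exact ⟨ρa r', by rw [← map_mul, e, map_mul]⟩
      · exact ⟨0, by simp⟩
      · rintro M M' ⟨M1, e1⟩ ⟨M2, e2⟩
        exact ⟨M1 + M2, by rw [mul_add, e1, e2, add_mul]⟩
      · rintro b M ⟨M1, e1⟩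
        exact ⟨b • M1, by rw [mul_smul_comm, e1, smul_mul_assoc]⟩
    · rw [← map_pow, hρa, specialize_eq_scalar ρ _ _ hf]
      have : eval₂ (AlgHom.id k K).toRingHom a f = 0 := ha
      rw [this, map_zero]
  obtain ⟨g, hg⟩ : ∃ g, ρX t = Matrix.scalar (Fin d) g := by
    refine exists_eq_scalar_of_eval_centralizer a ?_
    apply hspan
    · intro r
      have hr : r ∈ Algebra.adjoin k D := hD ▸ Algebra.mem_top
      induction hr using Algebra.adjoin_induction with
      | mem g hg =>
        rcases hcomm _ ρa hτ0 g hg with h1 | h1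
        · exact ⟨ρX g, h1.map ρX, heval g⟩
        · obtain ⟨e, he⟩ := exists_eq_scalar_of_commute ρ (AlgHom.id k K) hρ (M := ρa g)
            (fun b => by simpa [hρa] using h1 (C b))
          refine ⟨Matrix.scalar (Fin d) (C e), Matrix.scalar_commute _ (fun _ => Commute.all _ _) _,
            ?_⟩
          rw [he]
          ext i j
          simp [Matrix.diagonal_apply, apply_ite (eval a)]
      | algebraMap c =>
        exact ⟨ρX (algebraMap k _ c), (Algebra.commute_algebraMap_left c t).map ρX, heval _⟩
      | add r s _ _ hr hs =>
        obtain ⟨v, hv, ev⟩ := hr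
        obtain ⟨w, hw, ew⟩ := hs
        refine ⟨v + w, hv.add_left hw, ?_⟩
        rw [map_add, ← ev, ← ew]
        ext i j; simp
      | mul r s _ _ hr hs =>
        obtain ⟨v, hv, ev⟩ := hr
        obtain ⟨w, hw, ew⟩ := hs
        refine ⟨v * w, hv.mul_left hw, ?_⟩
        rw [map_mul, ← ev, ← ew]
        exact Matrix.map_mul (f := evalRingHom a)
    · exact ⟨0, by simp, by ext; simp⟩
    · rintro M M' ⟨v, hv, ev⟩ ⟨w, hw, ew⟩
      refine ⟨v + w, hv.add_left hw, ?_⟩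
      rw [← ev, ← ew]
      ext i j; simp
    · rintro b M ⟨v, hv, ev⟩
      refine ⟨C b • v, hv.smul_left _, ?_⟩
      rw [← ev]
      ext i j; simp
  have hgN : g ^ N = f := by
    have h1 : ρX (t ^ N) = Matrix.scalar (Fin d) f := by
      rw [hρX, specialize_eq_scalar ρ _ _ hf]
      congr 1
      exact eval₂_C_X
    rw [map_pow, hg, ← map_pow] at h1
    exact Matrix.scalar_inj.mp h1
  have hgd : g.natDegree ≠ 0 := fun h0 => hfd (by rw [← hgN, natDegree_pow, h0, mul_zero])
  have hx0 : ρX x = 0 := by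
    have h1 : ρX x * ρX t = q • (ρX t * ρX x) := by rw [← map_mul, hx, map_smul, map_mul]
    rw [hg, (Matrix.scalar_commute g (fun _ => Commute.all _ _) (ρX x)).eq] at h1
    ext1 i j
    have h2 := congrFun (congrFun h1 i) j
    simp only [Matrix.scalar_apply, Matrix.mul_diagonal, Matrix.smul_apply] at h2
    have h3 : (C (algebraMap k K (1 - q)) * g) * ρX x i j = 0 := by
      rw [Algebra.smul_def, Polynomial.algebraMap_apply] at h2
      rw [map_sub, map_one, map_sub, map_one, mul_assoc, sub_mul, sub_eq_zero, one_mul,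
        mul_comm g]
      exact h2
    refine (mul_eq_zero.mp h3).resolve_left (mul_ne_zero ?_ ?_)
    · rw [Ne, C_eq_zero, map_eq_zero, sub_eq_zero]
      exact fun h => hq h.symm
    · rintro rfl; simp at hgd
  have h1 : ρX (aeval t h) = 0 := by rw [← hxy, map_mul, hx0, zero_mul]
  rw [← aeval_algHom_apply, hg] at h1
  have h2 : aeval g h = 0 := by
    have h3 : aeval (Matrix.scalar (Fin d) g) h = Matrix.scalar (Fin d) (aeval g h) := by
      have := aeval_algHom_apply (Matrix.scalarAlgHom (α := K[X]) (Fin d) k) g h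
      exact this
    rw [h3] at h1
    exact Matrix.scalar_inj.mp (h1.trans (map_zero _).symm)
  have h3 : (h.map (algebraMap k K)).comp g = 0 := by
    rw [comp, eval₂_map, ← h2, aeval_def]; rfl
  rcases comp_eq_zero_iff.mp h3 with h4 | h4
  · exact hh ((Polynomial.map_eq_zero _).mp h4)
  · exact hgd (by rw [h4.2, natDegree_C])

end NormalElement

section Represents

universe u v

variable {k B E n : Type*} [Field k] [Ring B] [Algebra k B] [CommRing E] [Algebra k E]
  [Fintype n] [DecidableEq n] {ρ : B →ₐ[k] Matrix n n E}

theorem Represents.mul {z w : B[X]} {f g : E[X]} (hf : Represents ρ z f) (hg : Represents ρ w g) :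
    Represents ρ (z * w) (f * g) := by
  intro i
  rw [coeff_mul, coeff_mul, map_sum, map_sum]
  exact Finset.sum_congr rfl fun a _ => by rw [map_mul, hf, hg, map_mul]

theorem Represents.eq_C_of_isNilpotent [IsDomain E] [Nonempty n] {z : B[X]} {f : E[X]}
    (hf : Represents ρ z f) (hz : ∀ i ≠ 0, IsNilpotent (z.coeff i)) : f = C (f.coeff 0) := by
  ext i
  rw [coeff_C]
  split_ifs with h
  · rw [h]
  · have h1 : IsNilpotent (Matrix.scalar n (f.coeff i)) := hf i ▸ (hz i h).map ρ
    have h2 : Function.Injective (Matrix.scalar (α := E) n) := fun _ _ => Matrix.scalar_inj.mp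
    exact ((IsNilpotent.map_iff h2).mp h1).eq_zero

theorem natDegree_eq_zero_of_mem_fg {K : Type*} [Field K] [Nonempty n]
    (S : Subalgebra K (Matrix n n K[X])) (hS : (Subalgebra.toSubmodule S).FG) {f : K[X]}
    (hf : Matrix.scalar n f ∈ S) : f.natDegree = 0 := by
  have h1 : IsIntegral K (Matrix.scalarAlgHom (α := K[X]) n K f) := .of_mem_of_fg S hS _ hf
  have h2 : Function.Injective (Matrix.scalarAlgHom (α := K[X]) n K) :=
    fun _ _ => Matrix.scalar_inj.mp
  rw [isIntegral_algHom_iff _ h2] at h1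
  by_contra h0
  refine (Polynomial.transcendental f h0 ?_) h1.isAlgebraic
  rw [mem_nonZeroDivisors_iff_ne_zero, leadingCoeff_ne_zero]
  rintro rfl
  simp at h0

theorem isNilpotent_coeff_of_natDegree_eq_zero {k : Type v} {B : Type u} [Field k] [Ring B]
    [Algebra k B] (hB : SeparatesCenter k B) {z : B[X]} (hz : ∀ r, Commute z r)
    (H : ∀ (K : Type u) [Field K] [IsAlgClosed K] [Algebra k K] (d : ℕ) [NeZero d]
      (ρ : B →ₐ[k] Matrix (Fin d) (Fin d) K), Submodule.span K (Set.range ρ) = ⊤ →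
      ∀ f, Represents ρ z f → f.natDegree = 0) :
    ∀ i ≠ 0, IsNilpotent (z.coeff i) := by
  intro i hi
  by_contra hnil
  obtain ⟨K, _, _, _, d, _, ρ, hρ, hρc⟩ := hB _ (commute_coeff hz i) hnil
  obtain ⟨f, hf⟩ := exists_polynomial_of_central ρ hρ hz
  have h1 := H K d ρ hρ f hf
  refine hρc ?_
  rw [hf, coeff_eq_zero_of_natDegree_lt (by omega), map_zero]

/-- Elements algebraic over constants: if `t ^ N` is central and its higher coefficients are
nilpotent, then so are the higher coefficients of every central polynomial in `t`. -/
theorem natDegree_eq_zero_of_aeval {k B K : Type*} [Field k] [Ring B] [Algebra k B]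
    [Field K] [Algebra k K] [Nonempty n] {ρ : B →ₐ[k] Matrix n n K}
    (hρ : Submodule.span K (Set.range ρ) = ⊤) {t : B[X]} {N : ℕ} (hN : 0 < N)
    (hT : ∀ r, Commute (t ^ N) r) (hTn : ∀ i ≠ 0, IsNilpotent ((t ^ N).coeff i)) {g : k[X]}
    {f : K[X]} (hf : Represents ρ (aeval t g) f) : f.natDegree = 0 := by
  obtain ⟨f', hf'⟩ := exists_polynomial_of_central ρ hρ hT
  have h1 := Represents.eq_C_of_isNilpotent hf' hTn
  set ρX := specialize ρ (CAlgHom : K →ₐ[k] K[X]) X with hρX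
  have h2 : ρX t ^ N = algebraMap K _ (f'.coeff 0) := by
    rw [← map_pow, hρX, specialize_eq_scalar ρ _ _ hf', h1, coeff_C_zero]
    ext i j
    simp [Matrix.algebraMap_matrix_apply, Matrix.diagonal_apply]
  have h3 : IsIntegral K (ρX t) := by
    refine ⟨X ^ N - C (f'.coeff 0), monic_X_pow_sub_C _ hN.ne', ?_⟩
    simp [h2]
  refine natDegree_eq_zero_of_mem_fg (n := n) _ h3.fg_adjoin_singleton ?_
  have h4 : ρX (aeval t g) = Matrix.scalar n f := by
    rw [hρX, specialize_eq_scalar ρ _ _ hf]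
    congr 1
    exact eval₂_C_X
  rw [← h4, ← aeval_algHom_apply, ← aeval_map_algebraMap K]
  exact aeval_mem_adjoin_singleton K _

end Represents

theorem mul_pow_eq_smul_pow_mul {k R : Type*} [Field k] [Ring R] [Algebra k R] {t x : R}
    {a : k} (hx : x * t = a • (t * x)) (n : ℕ) : x * t ^ n = a ^ n • (t ^ n * x) := by
  induction n with
  | zero => simp
  | succ n ih =>
    rw [pow_succ, ← mul_assoc, ih, smul_mul_assoc, mul_assoc, hx, mul_smul_comm, smul_smul,
      mul_assoc, ← pow_succ]

theorem mul_aeval_eq_aeval_smul_mul {k R : Type*} [Field k] [Ring R] [Algebra k R] {t x : R}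
    {a : k} (hx : x * t = a • (t * x)) (f : k[X]) : x * aeval t f = aeval (a • t) f * x := by
  induction f using Polynomial.induction_on' with
  | add p q hp hq => rw [map_add, map_add, mul_add, add_mul, hp, hq]
  | monomial n b => rw [aeval_monomial, aeval_monomial, ← mul_assoc, ← Algebra.commutes b x,
      mul_assoc, mul_pow_eq_smul_pow_mul hx, _root_.smul_pow, mul_assoc,
      smul_mul_assoc]

section WeylExtension

universe u v

/-- `R` is generated over the family `G` by `x` and `y`, which `q`-commute with the members of `G`
and multiply to polynomials in `t = G i₀`; homomorphisms can be changed on `x` and `y`. -/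
structure IsWeylExtension {k : Type v} {R : Type*} {ι : Type*} [Field k] [Ring R] [Algebra k R]
    (G : ι → R) (c : ι → k) (i₀ : ι) (h : k[X]) (x y : R) : Prop where
  c_ne_zero : ∀ i, c i ≠ 0
  x_mul : ∀ i, x * G i = c i • (G i * x)
  y_mul : ∀ i, y * G i = (c i)⁻¹ • (G i * y)
  xy : x * y = aeval (G i₀) h
  yx : y * x = aeval ((c i₀)⁻¹ • G i₀) h
  adjoin_eq_top : Algebra.adjoin k (insert x (insert y (Set.range G))) = ⊤
  exists_algHom : ∀ (E : Type u) [Ring E] [Algebra k E] (ρ : R →ₐ[k] E) (x' y' : E),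
    (∀ i, x' * ρ (G i) = c i • (ρ (G i) * x')) → (∀ i, y' * ρ (G i) = (c i)⁻¹ • (ρ (G i) * y')) →
    x' * y' = aeval (ρ (G i₀)) h → y' * x' = aeval ((c i₀)⁻¹ • ρ (G i₀)) h →
    ∃ σ : R →ₐ[k] E, (∀ i, σ (G i) = ρ (G i)) ∧ σ x = x' ∧ σ y = y'

variable {k : Type v} {R : Type*} {ι : Type*} [Field k] [Ring R] [Algebra k R]
  {G : ι → R} {c : ι → k} {i₀ : ι} {h : k[X]} {x y : R}

theorem aeval_smul_eq_aeval_comp (a : k) (t : R) (f : k[X]) :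
    aeval (a • t) f = aeval t (f.comp (C a * X)) := by
  rw [aeval_comp]
  simp [Algebra.smul_def]

theorem IsWeylExtension.swap (W : IsWeylExtension.{u} G c i₀ h x y) :
    IsWeylExtension.{u} G (fun i => (c i)⁻¹) i₀ (h.comp (C (c i₀)⁻¹ * X)) y x := by
  have e : ∀ {E : Type _} [Ring E] [Algebra k E] (τ : E),
      aeval ((c i₀)⁻¹⁻¹ • τ) (h.comp (C (c i₀)⁻¹ * X)) = aeval τ h := by
    intro E _ _ τ
    rw [← aeval_smul_eq_aeval_comp, smul_smul, inv_inv, inv_mul_cancel₀ (W.c_ne_zero _), one_smul]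
  refine ⟨fun i => inv_ne_zero (W.c_ne_zero i), W.y_mul, fun i => by rw [inv_inv, W.x_mul],
    by rw [W.yx, aeval_smul_eq_aeval_comp], ?_, ?_, ?_⟩
  · rw [W.xy]
    rw [← aeval_smul_eq_aeval_comp, smul_smul, inv_inv, inv_mul_cancel₀ (W.c_ne_zero _), one_smul]
  · rw [Set.insert_comm]; exact W.adjoin_eq_top
  · intro E _ _ ρ x' y' h1 h2 h3 h4
    obtain ⟨σ, a1, a2, a3⟩ := W.exists_algHom E ρ y' x' (fun i => by simpa using h2 i) h1
      (by rw [h4, e]) (by rw [h3, aeval_smul_eq_aeval_comp])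
    exact ⟨σ, a1, a3, a2⟩

theorem exists_pow_mul_pow_eq_aeval {t x y : R} {a : k} (hx : x * t = a • (t * x))
    (hxy : x * y = aeval t h) (n : ℕ) : ∃ g : k[X], x ^ n * y ^ n = aeval t g := by
  induction n with
  | zero => exact ⟨1, by simp⟩
  | succ n ih =>
    obtain ⟨g, hg⟩ := ih
    refine ⟨g.comp (C a * X) * h, ?_⟩
    rw [pow_succ' x, pow_succ y, mul_assoc, ← mul_assoc (x ^ n), hg, ← mul_assoc,
      mul_aeval_eq_aeval_smul_mul hx, mul_assoc, hxy, aeval_smul_eq_aeval_comp, map_mul]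

variable (W : IsWeylExtension.{u} G c i₀ h x y)
include W

theorem IsWeylExtension.x_normalizes :
    ∀ s ∈ Algebra.adjoin k (Set.range G), ∃ s' ∈ Algebra.adjoin k (Set.range G), x * s = s' * x := by
  refine normalizes_adjoin ?_
  rintro _ ⟨i, rfl⟩
  exact ⟨c i • G i, Subalgebra.smul_mem _ (Algebra.subset_adjoin (Set.mem_range_self i)) _,
    by rw [W.x_mul, smul_mul_assoc]⟩

theorem IsWeylExtension.xy_mem : x * y ∈ Algebra.adjoin k (Set.range G) := by
  rw [W.xy]
  exact Algebra.adjoin_mono (s := {G i₀}) (Set.singleton_subset_iff.mpr (Set.mem_range_self i₀))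
    (aeval_mem_adjoin_singleton k (G i₀))

theorem IsWeylExtension.yx_mem : y * x ∈ Algebra.adjoin k (Set.range G) := by
  rw [W.yx, aeval_smul_eq_aeval_comp]
  exact Algebra.adjoin_mono (s := {G i₀}) (Set.singleton_subset_iff.mpr (Set.mem_range_self i₀))
    (aeval_mem_adjoin_singleton k (G i₀))

/-- Every element decomposes into homogeneous components with respect to `x` and `y`. -/
theorem IsWeylExtension.exists_decomposition (r : R) :
    ∃ s : ℤ → R, (∀ l, s l ∈ Algebra.adjoin k (Set.range G)) ∧ ∃ I : Finset ℤ,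
      ∑ l ∈ I, s l * zword x y l = r := by
  have h1 := adjoin_le_iSup_gradedPiece (S := Algebra.adjoin k (Set.range G)) W.x_normalizes
    W.swap.x_normalizes W.xy_mem W.yx_mem
    (Set.insert_subset_insert (Set.insert_subset_insert Algebra.subset_adjoin))
    (r := r) (W.adjoin_eq_top ▸ Algebra.mem_top)
  obtain ⟨f, hf, e⟩ := (Submodule.mem_iSup_iff_exists_finsupp _ _).mp h1
  choose s hs hs' using fun l => mem_gradedPiece.mp (hf l)
  exact ⟨s, hs, f.support, by rw [← e, Finsupp.sum]; exact Finset.sum_congr rfl fun l _ => hs' l⟩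

omit W in
theorem zword_pow_eq {n : ℕ} (l : ℤ) (x y : R) : zword x y l ^ n = zword (x ^ n) (y ^ n) l := by
  rcases l with m | m
  · simp only [zword]
    rw [← pow_mul, ← pow_mul, mul_comm]
  · simp only [zword]
    rw [← pow_mul, ← pow_mul, mul_comm]

omit W in
theorem map_zword {M N F : Type*} [Monoid M] [Monoid N] [FunLike F M N] [MonoidHomClass F M N]
    (f : F) (x y : M) (l : ℤ) : f (zword x y l) = zword (f x) (f y) l := by
  rcases l with m | m <;> simp [zword]

omit W in
theorem zword_zero_zero {l : ℤ} (hl : l ≠ 0) : zword (0 : R) 0 l = 0 := by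
  rcases l with m | m
  · have : m ≠ 0 := fun h => hl (by simp [h])
    simp [zword, this]
  · simp [zword]

theorem IsWeylExtension.exists_pow_eq {s : R} (hs : s ∈ Algebra.adjoin k (Set.range G)) (l : ℤ)
    (n : ℕ) : ∃ s', (s * zword x y l) ^ n = s' * zword (x ^ n) (y ^ n) l := by
  have h1 : ∀ a ∈ Algebra.adjoin k (Set.range G), ∃ a' ∈ Algebra.adjoin k (Set.range G),
      zword x y l * a = a' * zword x y l := by
    rcases l with m | m
    · exact normalizes_pow W.x_normalizes m
    · exact normalizes_pow W.swap.x_normalizes (m + 1)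
  obtain ⟨s', -, e⟩ := exists_mul_pow_eq
    (S := (Algebra.adjoin k (Set.range G)).toSubmonoid) h1 hs n
  exact ⟨s', by rw [e, zword_pow_eq]⟩

end WeylExtension

section Twist

universe u v

open LaurentPolynomial

/-- Constant Laurent polynomial matrices. -/
noncomputable def constMatrix (k n F : Type*) [Field k] [Field F] [Algebra k F] [Fintype n]
    [DecidableEq n] : Matrix n n F →ₐ[k] Matrix n n F[T;T⁻¹] :=
  ((Algebra.ofId F F[T;T⁻¹]).restrictScalars k).mapMatrix

variable {k : Type v} {R ι F n : Type*} [Field k] [Ring R] [Algebra k R] [Field F] [Algebra k F]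
  [Fintype n] [DecidableEq n]

theorem coeff_T_smul_constMatrix (M : Matrix n n F) (a l : ℤ) (i j : n) :
    (((T a : F[T;T⁻¹]) • constMatrix k n F M) i j).coeff l = if a = l then M i j else 0 := by
  have : ((T a : F[T;T⁻¹]) • constMatrix k n F M) i j = LaurentPolynomial.C (M i j) * T a := by
    rw [mul_comm]; rfl
  rw [this, ← single_eq_C_mul_T]
  rw [AddMonoidAlgebra.coeff_single, Finsupp.single_apply]

theorem coeff_sum_T_smul_constMatrix (M : ℤ → Matrix n n F) (a : ℤ → ℤ)
    (ha : Function.Injective a) (I : Finset ℤ) {l : ℤ} (hl : l ∈ I) (i j : n) :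
    ((∑ b ∈ I, (T (a b) : F[T;T⁻¹]) • constMatrix k n F (M b)) i j).coeff (a l) = M l i j := by
  rw [Matrix.sum_apply]
  have : ∀ (J : Finset ℤ) (f : ℤ → F[T;T⁻¹]), (∑ b ∈ J, f b).coeff (a l) =
      ∑ b ∈ J, (f b).coeff (a l) := by
    intro J f
    induction J using Finset.induction_on with
    | empty => simp
    | insert b J hb ih => rw [Finset.sum_insert hb, Finset.sum_insert hb, ← ih]; simp
  rw [this, Finset.sum_eq_single l]
  · rw [coeff_T_smul_constMatrix, if_pos rfl]
  · intro b _ hb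
    rw [coeff_T_smul_constMatrix, if_neg (fun h => hb (ha h))]
  · exact fun h => absurd hl h

theorem eq_scalar_of_sum_T_smul (M : ℤ → Matrix n n F) (I : Finset ℤ) {e : F[T;T⁻¹]}
    (h : ∑ l ∈ I, (T l : F[T;T⁻¹]) • constMatrix k n F (M l) = Matrix.scalar n e) {l : ℤ} (hl : l ∈ I) :
    M l = Matrix.scalar n (e.coeff l) := by
  ext i j
  rw [← coeff_sum_T_smul_constMatrix (k := k) M id Function.injective_id I hl i j]
  simp only [id]
  rw [h]
  by_cases hij : i = j
  · simp [hij]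
  · simp [hij]

theorem eq_zero_of_sum_T_smul (M : ℤ → Matrix n n F) (I : Finset ℤ)
    (h : ∑ l ∈ I, (T (-l) : F[T;T⁻¹]) • constMatrix k n F (M l) = 0) {l : ℤ} (hl : l ∈ I) : M l = 0 := by
  ext i j
  rw [← coeff_sum_T_smul_constMatrix (k := k) M Neg.neg neg_injective I hl i j, h]
  simp

theorem zword_T_smul (P Q : Matrix n n F) (a l : ℤ) :
    zword ((T a : F[T;T⁻¹]) • constMatrix k n F P) ((T (-a) : F[T;T⁻¹]) • constMatrix k n F Q) l =
      (T (a * l) : F[T;T⁻¹]) • constMatrix k n F (zword P Q l) := by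
  rcases l with m | m
  · simp only [zword]
    rw [_root_.smul_pow, T_pow, map_pow, mul_comm]
    rfl
  · simp only [zword]
    rw [_root_.smul_pow, T_pow, map_pow]
    congr 2
    push_cast [Int.negSucc_eq]
    ring

variable {G : ι → R} {c : ι → k} {i₀ : ι} {h : k[X]} {x y : R}

theorem map_mul_zword_of_eq {σ : R →ₐ[k] Matrix n n F} {τ : R →ₐ[k] Matrix n n F[T;T⁻¹]}
    {P Q : Matrix n n F} {a : ℤ} (hG : ∀ i, τ (G i) = constMatrix k n F (σ (G i)))
    (hx : τ x = (T a : F[T;T⁻¹]) • constMatrix k n F P) (hy : τ y = (T (-a) : F[T;T⁻¹]) • constMatrix k n F Q)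
    {s : R} (hs : s ∈ Algebra.adjoin k (Set.range G)) (l : ℤ) :
    τ (s * zword x y l) = (T (a * l) : F[T;T⁻¹]) • constMatrix k n F (σ s * zword P Q l) := by
  have h1 : τ s = constMatrix k n F (σ s) := by
    have h2 : Set.EqOn τ ((constMatrix k n F).comp σ) (Set.range G) := by
      rintro _ ⟨i, rfl⟩
      exact hG i
    exact AlgHom.eqOn_adjoin_iff.mpr h2 hs
  rw [map_mul, map_zword, hx, hy, zword_T_smul, h1, map_mul, mul_smul_comm]

end Twist

section Twist

universe u v

open LaurentPolynomial

variable {k : Type v} {R ι : Type*} {F : Type u} [Field k] [Ring R] [Algebra k R] [Field F]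
  [Algebra k F] {d : ℕ} {G : ι → R} {c : ι → k} {i₀ : ι} {h : k[X]} {x y : R}
  (W : IsWeylExtension.{u} G c i₀ h x y) (σ : R →ₐ[k] Matrix (Fin d) (Fin d) F)
include W

theorem IsWeylExtension.exists_twist :
    ∃ τ : R →ₐ[k] Matrix (Fin d) (Fin d) F[T;T⁻¹],
      (∀ i, τ (G i) = constMatrix k _ F (σ (G i))) ∧
      τ x = (T 1 : F[T;T⁻¹]) • constMatrix k _ F (σ x) ∧ τ y = (T (-1) : F[T;T⁻¹]) • constMatrix k _ F (σ y) := by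
  have hT : (T 1 * T (-1) : F[T;T⁻¹]) = 1 := by rw [← T_add]; simp
  have hT' : (T (-1) * T 1 : F[T;T⁻¹]) = 1 := by rw [← T_add]; simp
  refine W.exists_algHom (Matrix (Fin d) (Fin d) F[T;T⁻¹]) ((constMatrix k _ F).comp σ) _ _
    (fun i => ?_) (fun i => ?_) ?_ ?_
  · rw [AlgHom.comp_apply, smul_mul_assoc, mul_smul_comm, ← map_mul, ← map_mul, ← map_mul,
      ← map_mul, W.x_mul, map_smul, map_smul, smul_comm]
  · rw [AlgHom.comp_apply, smul_mul_assoc, mul_smul_comm, ← map_mul, ← map_mul, ← map_mul,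
      ← map_mul, W.y_mul, map_smul, map_smul, smul_comm]
  · rw [aeval_algHom_apply, ← W.xy, smul_mul_smul_comm, hT, one_smul, AlgHom.comp_apply, map_mul,
      map_mul]
  · rw [← map_smul ((constMatrix k _ F).comp σ) (c i₀)⁻¹ (G i₀), aeval_algHom_apply, ← W.yx, smul_mul_smul_comm, hT', one_smul,
      AlgHom.comp_apply, map_mul, map_mul]

theorem IsWeylExtension.exists_inverse_twist {w : Matrix (Fin d) (Fin d) F} (hw : w * σ x = 1)
    (hw' : σ x * w = 1) :
    ∃ τ : R →ₐ[k] Matrix (Fin d) (Fin d) F[T;T⁻¹],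
      (∀ i, τ (G i) = constMatrix k _ F (σ (G i))) ∧
      τ x = (T (-1) : F[T;T⁻¹]) • constMatrix k _ F (σ (x * y * x)) ∧ τ y = (T 1 : F[T;T⁻¹]) • constMatrix k _ F w := by
  have hT : (T 1 * T (-1) : F[T;T⁻¹]) = 1 := by rw [← T_add]; simp
  have hT' : (T (-1) * T 1 : F[T;T⁻¹]) = 1 := by rw [← T_add]; simp
  have hc := W.c_ne_zero
  refine W.exists_algHom (Matrix (Fin d) (Fin d) F[T;T⁻¹]) ((constMatrix k _ F).comp σ) _ _
    (fun i => ?_) (fun i => ?_) ?_ ?_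
  · have e : x * y * x * G i = c i • (G i * (x * y * x)) := by
      rw [mul_assoc, W.x_mul, mul_smul_comm]
      congr 1
      have : x * y * G i = G i * (x * y) := by
        rw [mul_assoc, W.y_mul, mul_smul_comm, ← mul_assoc, W.x_mul, smul_mul_assoc, smul_smul,
          inv_mul_cancel₀ (hc i), one_smul, mul_assoc]
      rw [← mul_assoc, this]
      simp only [mul_assoc]
    rw [AlgHom.comp_apply, smul_mul_assoc, mul_smul_comm, ← map_mul, ← map_mul, ← map_mul,
      ← map_mul, e, map_smul, map_smul, smul_comm]
  · have e : w * σ (G i) = (c i)⁻¹ • (σ (G i) * w) := by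
      have h1 : σ x * σ (G i) = c i • (σ (G i) * σ x) := by rw [← map_mul, W.x_mul, map_smul, map_mul]
      have h2 : w * (σ x * σ (G i)) * w = w * (c i • (σ (G i) * σ x)) * w := by rw [h1]
      rw [← mul_assoc, hw, one_mul, mul_smul_comm, smul_mul_assoc, mul_assoc w, mul_assoc, hw',
        mul_one] at h2
      rw [h2, smul_smul, inv_mul_cancel₀ (hc i), one_smul]
    rw [AlgHom.comp_apply, smul_mul_assoc, mul_smul_comm, ← map_mul, ← map_mul,
      e, map_smul, smul_comm]
  · rw [aeval_algHom_apply, ← W.xy, smul_mul_smul_comm, hT', one_smul, AlgHom.comp_apply,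
      ← map_mul, map_mul σ, mul_assoc, hw', mul_one]
  · rw [← map_smul ((constMatrix k _ F).comp σ) (c i₀)⁻¹ (G i₀), aeval_algHom_apply, ← W.yx, smul_mul_smul_comm, hT, one_smul,
      AlgHom.comp_apply, ← map_mul, map_mul σ, map_mul σ, ← mul_assoc, ← mul_assoc, hw, one_mul,
      map_mul σ]

end Twist

section Components

universe u v

open LaurentPolynomial

theorem commute_of_commute_T_smul {F n : Type*} [Field F] [Fintype n] [DecidableEq n]
    {Z M : Matrix n n F[T;T⁻¹]} {a : ℤ} (h : Commute Z ((T a : F[T;T⁻¹]) • M)) : Commute Z M := by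
  have := h.smul_right (T (-a) : F[T;T⁻¹])
  rwa [smul_smul, ← T_add, neg_add_cancel, T_zero, one_smul] at this

variable {k : Type v} {B K F : Type u} [Field k] [Ring B] [Algebra k B] [Field K] [Algebra k K]
  [Field F] [Algebra k F] {d : ℕ} {ι : Type*} {G : ι → B[X]} {c : ι → k} {i₀ : ι} {h : k[X]}
  {x y : B[X]} {ρ : B →ₐ[k] Matrix (Fin d) (Fin d) K}

theorem exists_eq_scalar_of_commute_constMatrix
    (hρ : Submodule.span K (Set.range ρ) = ⊤) (φ : K →ₐ[k] F) (u : F) {D : Set B[X]}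
    (hD : Algebra.adjoin k D = ⊤) {Z : Matrix (Fin d) (Fin d) F[T;T⁻¹]}
    (hZ : ∀ g ∈ D, Commute Z (constMatrix k _ F (specialize ρ φ u g))) :
    ∃ e, Z = Matrix.scalar _ e := by
  have h1 : ∀ r : B[X], Commute Z (constMatrix k _ F (specialize ρ φ u r)) := by
    intro r
    have hr : r ∈ Algebra.adjoin k D := hD ▸ Algebra.mem_top
    induction hr using Algebra.adjoin_induction with
    | mem g hg => exact hZ g hg
    | algebraMap a => rw [AlgHom.commutes, AlgHom.commutes]; exact (Algebra.commutes a Z).symm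
    | add a b _ _ ha hb => rw [map_add, map_add]; exact ha.add_right hb
    | mul a b _ _ ha hb => rw [map_mul, map_mul]; exact ha.mul_right hb
  refine exists_eq_scalar_of_commute ρ
    (((Algebra.ofId F F[T;T⁻¹]).restrictScalars k).comp φ) hρ fun b => ?_
  have := h1 (C b)
  rwa [specialize_C] at this

variable (W : IsWeylExtension.{u} G c i₀ h x y)
include W

theorem IsWeylExtension.exists_specialize_eq_scalar (hρ : Submodule.span K (Set.range ρ) = ⊤)
    (φ : K →ₐ[k] F) (u : F) {z : B[X]} (hz : ∀ r, Commute z r) {s : ℤ → B[X]}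
    (hs : ∀ l, s l ∈ Algebra.adjoin k (Set.range G)) {I : Finset ℤ}
    (e : ∑ l ∈ I, s l * zword x y l = z) {l : ℤ} (hl : l ∈ I) :
    ∃ a, specialize ρ φ u (s l * zword x y l) = Matrix.scalar _ a := by
  set σ := specialize ρ φ u
  obtain ⟨τ, hG, hx, hy⟩ := W.exists_twist σ
  obtain ⟨b, hb⟩ := exists_eq_scalar_of_commute_constMatrix hρ φ u W.adjoin_eq_top (Z := τ z) (by
    rintro _ (rfl | rfl | ⟨i, rfl⟩)
    · exact commute_of_commute_T_smul (hx ▸ (hz _).map τ)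
    · exact commute_of_commute_T_smul (hy ▸ (hz _).map τ)
    · exact hG i ▸ (hz _).map τ)
  rw [← e, map_sum] at hb
  have h1 : ∀ l, τ (s l * zword x y l) =
      (T l : F[T;T⁻¹]) • constMatrix k _ F (σ (s l * zword x y l)) := fun l => by
    rw [map_mul_zword_of_eq hG hx hy (hs l), one_mul, map_mul σ, map_zword σ]
  simp only [h1] at hb
  exact ⟨_, eq_scalar_of_sum_T_smul _ I hb hl⟩

theorem IsWeylExtension.specialize_eq_zero (hρ : Submodule.span K (Set.range ρ) = ⊤)
    {ψ : K[X] →ₐ[k] F} (hψ : Function.Injective ψ) {l₀ : K} {n : ℕ}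
    (hx : specialize ρ (AlgHom.id k K) l₀ x ^ n = 0)
    (hy : specialize ρ (AlgHom.id k K) l₀ y ^ n = 0)
    {τ : B[X] →ₐ[k] Matrix (Fin d) (Fin d) F[T;T⁻¹]} {P Q : Matrix (Fin d) (Fin d) F}
    (hτG : ∀ i, τ (G i) = constMatrix k _ F (specialize ρ (ψ.comp CAlgHom) (ψ X) (G i)))
    (hτx : τ x = (T (-1) : F[T;T⁻¹]) • constMatrix k _ F P)
    (hτy : τ y = (T 1 : F[T;T⁻¹]) • constMatrix k _ F Q)
    {z : B[X]} (hz : ∀ r, Commute z r) (hτz : τ z = 0) :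
    specialize ρ (AlgHom.id k K) l₀ z = 0 := by
  obtain ⟨s, hs, I, e⟩ := W.exists_decomposition z
  set σ := specialize ρ (ψ.comp CAlgHom) (ψ X) with hσ
  set ρX := specialize ρ (CAlgHom : K →ₐ[k] K[X]) X with hρX
  set ρl := specialize ρ (AlgHom.id k K) l₀ with hρl
  have hψ' : ∀ r, ψ.mapMatrix (ρX r) = σ r := fun r => mapMatrix_specialize ρ CAlgHom X ψ r
  have hl' : ∀ r, ((aeval l₀).restrictScalars k : K[X] →ₐ[k] K).mapMatrix (ρX r) = ρl r := by
    intro r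
    rw [hρX, mapMatrix_specialize]
    congr 2
    · ext a; simp
    · simp
  rw [← e, map_sum]
  refine Finset.sum_eq_zero fun l hl => ?_
  by_cases h0 : l = 0
  · subst h0
    have h1 : ∀ l, τ (s l * zword x y l) =
        (T (-l) : F[T;T⁻¹]) • constMatrix k _ F (σ (s l) * zword P Q l) := fun l => by
      rw [map_mul_zword_of_eq hτG hτx (by simpa using hτy) (hs l), neg_one_mul]
    rw [← e, map_sum] at hτz
    simp only [h1] at hτz
    have h2 := eq_zero_of_sum_T_smul _ I hτz hl
    rw [show zword P Q 0 = 1 from pow_zero P, mul_one, ← hψ'] at h2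
    have h3 : ρX (s 0) = 0 := by
      refine Matrix.ext fun i j => hψ ?_
      simpa using congrFun (congrFun h2 i) j
    rw [show zword x y 0 = 1 from pow_zero x, mul_one, ← hl', h3, map_zero]
  · obtain ⟨a, ha⟩ := W.exists_specialize_eq_scalar hρ (AlgHom.id k K) l₀ hz hs e hl
    obtain ⟨s', hs'⟩ := W.exists_pow_eq (hs l) l n
    have h1 : ρl (s l * zword x y l) ^ n = 0 := by
      rw [← map_pow, hs', map_mul, map_zword ρl, map_pow, map_pow, hx, hy, zword_zero_zero h0,
        mul_zero]
    rw [← hρl] at ha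
    rw [ha] at h1 ⊢
    rcases isEmpty_or_nonempty (Fin d) with hd | hd
    · exact Subsingleton.elim _ _
    · rw [← map_pow, ← map_zero (Matrix.scalar (α := K) (Fin d)), Matrix.scalar_inj] at h1
      rw [IsNilpotent.eq_zero ⟨n, h1⟩, map_zero]

end Components

section Components

universe u v

open LaurentPolynomial

theorem specialize_pow_eq_scalar {k B K E n : Type*} [Field k] [Ring B] [Algebra k B] [Field K]
    [Algebra k K] [CommRing E] [Algebra k E] [Fintype n] [DecidableEq n]
    {ρ : B →ₐ[k] Matrix n n K} (ψ : K[X] →ₐ[k] E) {z : B[X]} {f : K[X]} (hf : Represents ρ z f) :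
    specialize ρ (ψ.comp CAlgHom) (ψ X) z = Matrix.scalar n (ψ f) := by
  rw [specialize_eq_scalar ρ _ _ hf]
  congr 1
  have h1 : (ψ.comp CAlgHom).toRingHom = ψ.toRingHom.comp Polynomial.C := by ext; simp
  rw [h1]
  have h2 := hom_eval₂ f Polynomial.C ψ.toRingHom X
  rw [eval₂_C_X] at h2
  exact h2.symm

theorem IsWeylExtension.isNilpotent_coeff_pow {k : Type v} {B : Type u} [Field k] [Ring B]
    [Algebra k B] {ι : Type*} {G : ι → B[X]} {c : ι → k} {i₀ : ι} {h : k[X]} {x y : B[X]}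
    (W : IsWeylExtension.{u} G c i₀ h x y) (hB : SeparatesCenter k B) {n N : ℕ} (hn : 0 < n)
    (hx : ∀ r, Commute (x ^ n) r) (hy : ∀ r, Commute (y ^ n) r) (hN : 0 < N)
    (hT : ∀ r, Commute (G i₀ ^ N) r) (hTn : ∀ i ≠ 0, IsNilpotent ((G i₀ ^ N).coeff i)) :
    ∀ i ≠ 0, IsNilpotent ((x ^ n).coeff i) := by
  obtain ⟨g, hg⟩ := exists_pow_mul_pow_eq_aeval (W.x_mul i₀) W.xy n
  refine isNilpotent_coeff_of_natDegree_eq_zero hB hx fun K _ _ _ d _ ρ hρ f hf => ?_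
  by_contra hdeg
  obtain ⟨f', hf'⟩ := exists_polynomial_of_central ρ hρ hy
  have hf0 : f ≠ 0 := by rintro rfl; simp at hdeg
  have hf'0 : f' = 0 := by
    by_contra h0
    have := natDegree_eq_zero_of_aeval hρ hN hT hTn (hg ▸ Represents.mul hf hf')
    rw [natDegree_mul hf0 h0] at this
    omega
  obtain ⟨l₀, hl₀⟩ := IsAlgClosed.exists_root f fun h => hdeg (natDegree_eq_of_degree_eq_some h)
  have hx0 : specialize ρ (AlgHom.id k K) l₀ x ^ n = 0 := by
    rw [← map_pow, specialize_eq_scalar ρ _ _ hf]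
    convert map_zero (Matrix.scalar (α := K) (Fin d))
    exact hl₀
  have hy0 : specialize ρ (AlgHom.id k K) l₀ y ^ n = 0 := by
    rw [← map_pow, specialize_eq_scalar ρ _ _ hf', hf'0, eval₂_zero, map_zero]
  let F := FractionRing K[X]
  let ψ : K[X] →ₐ[k] F := (Algebra.ofId K[X] F).restrictScalars k
  have hψ : Function.Injective ψ := IsFractionRing.injective K[X] F
  set σ := specialize ρ (ψ.comp CAlgHom) (ψ X) with hσ
  have hσx : σ x ^ n = Matrix.scalar _ (ψ f) := by
    rw [← map_pow, hσ, specialize_pow_eq_scalar ψ hf]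
  have hσy : σ y ^ n = 0 := by
    rw [← map_pow, hσ, specialize_pow_eq_scalar ψ hf', hf'0, map_zero, map_zero]
  have hψf : ψ f ≠ 0 := (map_ne_zero_iff ψ hψ).mpr hf0
  obtain ⟨m, rfl⟩ : ∃ m, n = m + 1 := ⟨n - 1, by omega⟩
  obtain ⟨w, hw, hw'⟩ : ∃ w, w * σ x = 1 ∧ σ x * w = 1 := by
    have h1 : (ψ f)⁻¹ • σ x ^ (m + 1) = 1 := by
      rw [hσx, Matrix.scalar_apply, ← Matrix.diagonal_smul]
      ext i j
      simp [Matrix.diagonal_apply, Matrix.one_apply, hψf]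
    exact ⟨(ψ f)⁻¹ • σ x ^ m, by rw [smul_mul_assoc, ← pow_succ, h1],
      by rw [mul_smul_comm, ← pow_succ', h1]⟩
  obtain ⟨τ, hτG, hτx, hτy⟩ := W.exists_inverse_twist σ hw hw'
  have hτ : ∀ z : B[X], (∀ r, Commute z r) → ∃ e, τ z = Matrix.scalar _ e := by
    intro z hz
    have hzw : Commute (τ z) (constMatrix k _ F w) :=
      commute_of_commute_T_smul (hτy ▸ (hz _).map τ)
    have hzx : Commute (τ z) (constMatrix k _ F (σ x)) := by
      have h1 : constMatrix k _ F w * constMatrix k _ F (σ x) = 1 := by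
        rw [← map_mul, hw, map_one]
      have h2 : constMatrix k _ F (σ x) * constMatrix k _ F w = 1 := by
        rw [← map_mul, hw', map_one]
      exact hzw.units_inv_right (u := ⟨_, _, h1, h2⟩)
    have hzy : Commute (τ z) (constMatrix k _ F (σ y)) := by
      have h1 : Commute (τ z) (constMatrix k _ F (σ (x * y * x))) :=
        commute_of_commute_T_smul (hτx ▸ (hz _).map τ)
      have h2 : σ y = w * σ (x * y * x) * w := by
        rw [map_mul, map_mul, ← mul_assoc, ← mul_assoc, hw, one_mul, mul_assoc, hw', mul_one]
      rw [h2, map_mul, map_mul]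
      exact (hzw.mul_right h1).mul_right hzw
    refine exists_eq_scalar_of_commute_constMatrix hρ (ψ.comp CAlgHom) (ψ X) W.adjoin_eq_top ?_
    rintro _ (rfl | rfl | ⟨i, rfl⟩)
    · exact hzx
    · exact hzy
    · exact hτG i ▸ (hz _).map τ
  have hC : ∀ b : B, (∀ a, Commute b a) → ∀ r : B[X], Commute (Polynomial.C b) r := by
    intro b hb r
    ext i
    rw [coeff_C_mul, coeff_mul_C, (hb _).eq]
  have hτC : ∀ b : B, (∀ a, Commute b a) → ∃ e, τ.comp CAlgHom b = Matrix.scalar _ e :=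
    fun b hb => hτ _ (hC b hb)
  obtain ⟨u, hu⟩ := hτ X fun r => commute_X r
  obtain ⟨xe, hxe⟩ := exists_represents hτC hx
  obtain ⟨ye, hye⟩ := exists_represents hτC hy
  have hH := hxe.mul hye
  have hHn := isNilpotent_coeff_of_natDegree_eq_zero hB (fun r => (hx r).mul_left (hy r))
    fun K _ _ _ d _ ρ hρ f hf => natDegree_eq_zero_of_aeval hρ hN hT hTn (hg ▸ hf)
  have hH0 : τ (x ^ (m + 1) * y ^ (m + 1)) = 0 := by
    have h1 : constMatrix k _ F (σ (x ^ (m + 1) * y ^ (m + 1))) = 0 := by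
      rw [map_mul, map_pow σ y, hσy, mul_zero, map_zero]
    rw [hg, ← AlgHom.comp_apply, ← aeval_algHom_apply, AlgHom.comp_apply, ← hτG] at h1
    rw [hg, ← aeval_algHom_apply, h1]
  have hz : xe * ye = 0 := by
    have h1 := hH.eq_C_of_isNilpotent hHn
    have h2 := hH.map_eq hu
    rw [h1, eval_C, hH0, ← map_zero (Matrix.scalar _), Matrix.scalar_inj] at h2
    rw [h1, ← h2, Polynomial.C_0]
  have hye0 : ye ≠ 0 := by
    rintro rfl
    have h1 := hye.map_eq hu
    rw [eval_zero, map_zero, map_pow] at h1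
    have h2 : τ y * ((T (-1) : F[T;T⁻¹]) • constMatrix k _ F (σ x)) = 1 := by
      rw [hτy, smul_mul_smul_comm, ← T_add, ← map_mul, hw]
      simp
    have h3 := (IsUnit.of_mul_eq_one _ h2).pow (m + 1)
    rw [h1] at h3
    exact not_isUnit_zero h3
  have hxe0 : xe = 0 := (mul_eq_zero.mp hz).resolve_right hye0
  have h1 := hxe f.natDegree
  rw [hxe0, coeff_zero, map_zero, AlgHom.comp_apply, CAlgHom_apply] at h1
  have h2 := W.specialize_eq_zero hρ hψ hx0 hy0 hτG hτx hτy
    (hC _ (commute_coeff hx f.natDegree)) h1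
  rw [specialize_C, hf, AlgHom.mapMatrix_apply] at h2
  apply hf0
  rw [← leadingCoeff_eq_zero, leadingCoeff]
  simpa using congrFun (congrFun h2 0) 0

end Components

section Relations

theorem pow_mul_eq_smul_mul_pow {k R : Type*} [Field k] [Ring R] [Algebra k R] {t x : R}
    {a : k} (hx : x * t = a • (t * x)) (n : ℕ) : x ^ n * t = a ^ n • (t * x ^ n) := by
  induction n with
  | zero => simp
  | succ n ih =>
    rw [pow_succ, mul_assoc, hx, mul_smul_comm, ← mul_assoc, ih, smul_mul_assoc, smul_smul,
      mul_assoc, ← pow_succ, ← pow_succ']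

theorem commute_pow_of_mul_eq_aeval {k R : Type*} [Field k] [Ring R] [Algebra k R] {t x y : R}
    {a : k} {h : k[X]} (hx : x * t = a • (t * x)) (hxy : x * y = aeval t h)
    (hyx : y * x = aeval (a⁻¹ • t) h) {n : ℕ} (hn : a ^ n = 1) : Commute (x ^ n) y := by
  rcases n with _ | n
  · simp
  · have h1 : ∀ n : ℕ, x ^ n * aeval t h = aeval (a ^ n • t) h * x ^ n := fun n =>
      mul_aeval_eq_aeval_smul_mul (pow_mul_eq_smul_mul_pow hx n) h
    have h2 : a ^ n = a⁻¹ := eq_inv_of_mul_eq_one_left (by rw [← pow_succ, hn])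
    rw [commute_iff_eq, pow_succ, mul_assoc, hxy, h1, h2, ← hyx, mul_assoc, ← pow_succ', pow_succ]

/-- The relations among the generators of a tensor product of quantum generalized Weyl algebras;
the pair `x p`, `y p` belongs to the tensor factor of `t (π p)`. -/
structure GWARelations {k R J P : Type*} [Field k] [Ring R] [Algebra k R] (π : P → J) (q : P → k)
    (h : P → k[X]) (t : J → R) (x y : P → R) : Prop where
  t_t : ∀ i j, Commute (t i) (t j)
  x_t : ∀ p, x p * t (π p) = q p • (t (π p) * x p)
  y_t : ∀ p, y p * t (π p) = (q p)⁻¹ • (t (π p) * y p)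
  x_t_of_ne : ∀ p j, π p ≠ j → Commute (x p) (t j)
  y_t_of_ne : ∀ p j, π p ≠ j → Commute (y p) (t j)
  x_y : ∀ p, x p * y p = aeval (t (π p)) (h p)
  y_x : ∀ p, y p * x p = aeval ((q p)⁻¹ • t (π p)) (h p)
  x_x : ∀ p p', p ≠ p' → Commute (x p) (x p')
  y_y : ∀ p p', p ≠ p' → Commute (y p) (y p')
  x_y_of_ne : ∀ p p', p ≠ p' → Commute (x p) (y p')

variable {k R R' J P : Type*} [Field k] [Ring R] [Algebra k R] [Ring R'] [Algebra k R']
  {π : P → J} {q : P → k} {h : P → k[X]} {t : J → R} {x y : P → R}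

theorem GWARelations.map (H : GWARelations π q h t x y) (f : R →ₐ[k] R') :
    GWARelations π q h (fun j => f (t j)) (fun p => f (x p)) (fun p => f (y p)) where
  t_t i j := (H.t_t i j).map f
  x_t p := by rw [← map_mul, H.x_t, map_smul, map_mul]
  y_t p := by rw [← map_mul, H.y_t, map_smul, map_mul]
  x_t_of_ne p j hj := (H.x_t_of_ne p j hj).map f
  y_t_of_ne p j hj := (H.y_t_of_ne p j hj).map f
  x_y p := by rw [← map_mul, H.x_y, aeval_algHom_apply]
  y_x p := by rw [← map_mul, H.y_x, ← map_smul, aeval_algHom_apply]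
  x_x p p' hp := (H.x_x p p' hp).map f
  y_y p p' hp := (H.y_y p p' hp).map f
  x_y_of_ne p p' hp := (H.x_y_of_ne p p' hp).map f

/-- The set of generators. -/
def generators (s : R) (t : J → R) (x y : P → R) : Set R :=
  insert s (Set.range t ∪ (Set.range x ∪ Set.range y))

omit [Ring R] in
theorem forall_mem_generators {s : R} {p : R → Prop} : (∀ g ∈ generators s t x y, p g) ↔
    p s ∧ (∀ j, p (t j)) ∧ (∀ i, p (x i)) ∧ ∀ i, p (y i) := by
  simp [generators, or_imp, forall_and]

theorem commute_map_of_adjoin_eq_top {D : Set R} (hD : Algebra.adjoin k D = ⊤) (f : R →ₐ[k] R')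
    {z : R'} (hz : ∀ g ∈ D, Commute z (f g)) (r : R) : Commute z (f r) := by
  have hr : r ∈ Algebra.adjoin k D := hD ▸ Algebra.mem_top
  induction hr using Algebra.adjoin_induction with
  | mem g hg => exact hz g hg
  | algebraMap a => rw [f.commutes]; exact (Algebra.commutes a z).symm
  | add a b _ _ ha hb => rw [map_add]; exact ha.add_right hb
  | mul a b _ _ ha hb => rw [map_mul]; exact ha.mul_right hb

theorem commute_of_adjoin_eq_top {D : Set R} (hD : Algebra.adjoin k D = ⊤) {z : R}
    (hz : ∀ g ∈ D, Commute z g) (r : R) : Commute z r :=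
  commute_map_of_adjoin_eq_top hD (AlgHom.id k R) hz r

section Central

variable (H : GWARelations π q h t x y) {s : R} (hs : ∀ r, Commute s r)
  (hD : Algebra.adjoin k (generators s t x y) = ⊤) (hq : ∀ p, q p ≠ 0) {N : ℕ}
  (hN : ∀ p, q p ^ N = 1)
include H hs hD hN

theorem GWARelations.commute_t_pow (j : J) (r : R) : Commute (t j ^ N) r := by
  refine commute_of_adjoin_eq_top hD (forall_mem_generators.mpr
    ⟨(hs _).symm, fun i => (H.t_t j i).pow_left N, fun p => ?_, fun p => ?_⟩) r
  · by_cases hj : π p = j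
    · have := mul_pow_eq_smul_pow_mul (H.x_t p) N
      rw [hN, one_smul, hj] at this
      exact this.symm
    · exact ((H.x_t_of_ne p j hj).symm).pow_left N
  · by_cases hj : π p = j
    · have := mul_pow_eq_smul_pow_mul (H.y_t p) N
      rw [inv_pow, hN, inv_one, one_smul, hj] at this
      exact this.symm
    · exact ((H.y_t_of_ne p j hj).symm).pow_left N

theorem GWARelations.commute_x_pow (p : P) (r : R) : Commute (x p ^ N) r := by
  refine commute_of_adjoin_eq_top hD (forall_mem_generators.mpr
    ⟨(hs _).symm, fun j => ?_, fun p' => ?_, fun p' => ?_⟩) r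
  · by_cases hj : π p = j
    · have := pow_mul_eq_smul_mul_pow (H.x_t p) N
      rwa [hN, one_smul, hj] at this
    · exact (H.x_t_of_ne p j hj).pow_left N
  · by_cases hp : p = p'
    · rw [hp]; exact Commute.pow_self _ _
    · exact (H.x_x p p' hp).pow_left N
  · by_cases hp : p = p'
    · subst hp
      exact commute_pow_of_mul_eq_aeval (H.x_t p) (H.x_y p) (H.y_x p) (hN p)
    · exact (H.x_y_of_ne p p' hp).pow_left N

include hq in
theorem GWARelations.commute_y_pow (p : P) (r : R) : Commute (y p ^ N) r := by
  refine commute_of_adjoin_eq_top hD (forall_mem_generators.mpr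
    ⟨(hs _).symm, fun j => ?_, fun p' => ?_, fun p' => ?_⟩) r
  · by_cases hj : π p = j
    · have := pow_mul_eq_smul_mul_pow (H.y_t p) N
      rwa [inv_pow, hN, inv_one, one_smul, hj] at this
    · exact (H.y_t_of_ne p j hj).pow_left N
  · by_cases hp : p = p'
    · subst hp
      refine commute_pow_of_mul_eq_aeval (t := (q p)⁻¹ • t (π p)) (a := (q p)⁻¹) ?_ (H.y_x p) ?_
        (by rw [inv_pow, hN, inv_one])
      · rw [mul_smul_comm, H.y_t, smul_mul_assoc]
      · rw [smul_smul, inv_inv, mul_inv_cancel₀ (hq p), one_smul, H.x_y]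
    · exact (H.x_y_of_ne p' p (Ne.symm hp)).symm.pow_left N
  · by_cases hp : p = p'
    · rw [hp]; exact Commute.pow_self _ _
    · exact (H.y_y p p' hp).pow_left N

end Central

/-- The subalgebra generated by the generators over a central subring containing a power of each
of them is a finitely generated module. -/
theorem GWARelations.exists_fg [Finite J] [Finite P] (H : GWARelations π q h t x y) {Λ : Type*}
    [CommRing Λ] [Algebra Λ R] [Algebra k Λ] [IsScalarTower k Λ R] {N : ℕ} (hN : 0 < N)
    (ht : ∀ j, t j ^ N ∈ Set.range (algebraMap Λ R))
    (hx : ∀ p, x p ^ N ∈ Set.range (algebraMap Λ R))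
    (hy : ∀ p, y p ^ N ∈ Set.range (algebraMap Λ R)) :
    ∃ S : Subalgebra Λ R, (Subalgebra.toSubmodule S).FG ∧ (∀ j, t j ∈ S) ∧ (∀ p, x p ∈ S) ∧
      ∀ p, y p ∈ S := by
  classical
  have := Fintype.ofFinite J
  have := Fintype.ofFinite P
  have h0N : (0 : R) ^ N ∈ Set.range (algebraMap Λ R) := ⟨0, by simp [hN.ne']⟩
  have h1 : ∀ I : Finset J,
      (Subalgebra.toSubmodule (Algebra.adjoin Λ (insert 0 (t '' I)))).FG := by
    intro I
    induction I using Finset.induction_on with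
    | empty =>
      have : Algebra.adjoin Λ (insert (0 : R) (t '' (∅ : Finset J))) = ⊥ := by
        simp
      rw [this, Algebra.toSubmodule_bot]
      exact ⟨{1}, by simp [Submodule.one_eq_span]⟩
    | insert j I _ ih =>
      have e : (insert 0 (t '' (insert j I : Finset J)) : Set R) =
          insert (t j) (insert 0 (insert 0 (t '' I))) := by
        rw [Finset.coe_insert, Set.image_insert_eq, Set.insert_comm, Set.insert_idem]
      rw [e]
      refine fg_adjoin_insert_insert (normalizes_adjoin ?_) ?_ ?_ ?_ ih hN (ht j) h0N rfl
      · rintro _ (rfl | ⟨i, hi, rfl⟩)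
        · exact ⟨0, zero_mem _, by simp⟩
        · exact ⟨t i, Algebra.subset_adjoin (Set.mem_insert_of_mem _ ⟨i, hi, rfl⟩), H.t_t j i⟩
      · exact fun a _ => ⟨0, zero_mem _, by simp⟩
      · simp
      · simp
  have h2 : ∀ I : Finset P, (Subalgebra.toSubmodule (Algebra.adjoin Λ
      (insert 0 (Set.range t) ∪ (x '' I ∪ y '' I)))).FG := by
    intro I
    induction I using Finset.induction_on with
    | empty => simpa using h1 Finset.univ
    | insert p I hp ih =>
      set D : Set R := insert 0 (Set.range t) ∪ (x '' I ∪ y '' I)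
      have e : (insert 0 (Set.range t) ∪
          (x '' (insert p I : Finset P) ∪ y '' (insert p I : Finset P)) : Set R) =
          insert (x p) (insert (y p) D) := by
        ext g
        simp only [D, Set.mem_union, Set.mem_insert_iff, Set.mem_image, Finset.coe_insert,
          exists_eq_or_imp, eq_comm (a := g)]
        grind
      rw [e]
      have htm : ∀ j, t j ∈ Algebra.adjoin Λ D := fun j =>
        Algebra.subset_adjoin (Or.inl (Or.inr ⟨j, rfl⟩))
      have hmem : ∀ (a : k) (f : k[X]), aeval (a • t (π p)) f ∈ Algebra.adjoin Λ D := fun a f =>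
        (Algebra.adjoin_le (S := (Algebra.adjoin Λ D).restrictScalars k)
          (Set.singleton_subset_iff.mpr (Subalgebra.smul_mem ((Algebra.adjoin Λ D).restrictScalars k)
            (htm (π p)) a)))
          (aeval_mem_adjoin_singleton k (a • t (π p)))
      refine fg_adjoin_insert_insert (normalizes_adjoin ?_) (normalizes_adjoin ?_) ?_ ?_ ih hN
        (hx p) (hy p) rfl
      · rintro _ ((rfl | ⟨j, rfl⟩) | ⟨i, hi, rfl⟩ | ⟨i, hi, rfl⟩)
        · exact ⟨0, zero_mem _, by simp⟩
        · by_cases hj : π p = j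
          · subst hj
            exact ⟨q p • t (π p), Subalgebra.smul_mem ((Algebra.adjoin Λ D).restrictScalars k)
              (htm (π p)) _, by rw [H.x_t, smul_mul_assoc]⟩
          · exact ⟨t j, htm j, H.x_t_of_ne p j hj⟩
        · exact ⟨x i, Algebra.subset_adjoin (Or.inr (Or.inl ⟨i, hi, rfl⟩)),
            H.x_x p i (by rintro rfl; exact hp hi)⟩
        · exact ⟨y i, Algebra.subset_adjoin (Or.inr (Or.inr ⟨i, hi, rfl⟩)),
            H.x_y_of_ne p i (by rintro rfl; exact hp hi)⟩
      · rintro _ ((rfl | ⟨j, rfl⟩) | ⟨i, hi, rfl⟩ | ⟨i, hi, rfl⟩)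
        · exact ⟨0, zero_mem _, by simp⟩
        · by_cases hj : π p = j
          · subst hj
            exact ⟨(q p)⁻¹ • t (π p), Subalgebra.smul_mem ((Algebra.adjoin Λ D).restrictScalars k)
              (htm (π p)) _, by rw [H.y_t, smul_mul_assoc]⟩
          · exact ⟨t j, htm j, H.y_t_of_ne p j hj⟩
        · exact ⟨x i, Algebra.subset_adjoin (Or.inr (Or.inl ⟨i, hi, rfl⟩)),
            (H.x_y_of_ne i p (by rintro rfl; exact hp hi)).symm⟩
        · exact ⟨y i, Algebra.subset_adjoin (Or.inr (Or.inr ⟨i, hi, rfl⟩)),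
            H.y_y p i (by rintro rfl; exact hp hi)⟩
      · rw [H.x_y]; simpa using hmem 1 (h p)
      · rw [H.y_x]; exact hmem _ _
  exact ⟨_, h2 Finset.univ, fun j => Algebra.subset_adjoin (Or.inl (Or.inr ⟨j, rfl⟩)),
    fun p => Algebra.subset_adjoin (Or.inr (Or.inl ⟨p, by simp, rfl⟩)),
    fun p => Algebra.subset_adjoin (Or.inr (Or.inr ⟨p, by simp, rfl⟩))⟩

end Relations

section Presentation

universe u

/-- `R` is a polynomial ring in the central variable `s` over a tensor product of quantum
generalized Weyl algebras, as expressed by a presentation. -/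
structure IsGWAPresentation {k R J P : Type*} [Field k] [Ring R] [Algebra k R] (π : P → J)
    (q : P → k) (h : P → k[X]) (t : J → R) (x y : P → R) (s : R) : Prop
    extends GWARelations π q h t x y where
  commute_s : ∀ r, Commute s r
  adjoin_eq_top : Algebra.adjoin k (generators s t x y) = ⊤
  exists_algHom : ∀ (E : Type u) [Ring E] [Algebra k E] (t' : J → E) (x' y' : P → E) (s' : E),
    GWARelations π q h t' x' y' → (∀ g ∈ generators s' t' x' y', Commute s' g) →
    ∃ σ : R →ₐ[k] E, (∀ j, σ (t j) = t' j) ∧ (∀ p, σ (x p) = x' p) ∧ (∀ p, σ (y p) = y' p) ∧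
      σ s = s'

variable {k R R' J P : Type*} [Field k] [Ring R] [Algebra k R] [Ring R'] [Algebra k R']
  {π : P → J} {q : P → k} {h : P → k[X]} {t : J → R} {x y : P → R} {s : R}

omit [Ring R] [Ring R'] in
theorem map_generators (f : R → R') :
    f '' generators s t x y =
      generators (f s) (fun j => f (t j)) (fun p => f (x p)) (fun p => f (y p)) := by
  simp only [generators, Set.image_insert_eq, Set.image_union, ← Set.range_comp]
  rfl

theorem adjoin_generators_map (hD : Algebra.adjoin k (generators s t x y) = ⊤) (f : R →ₐ[k] R')
    (hf : Function.Surjective f) :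
    Algebra.adjoin k
      (generators (f s) (fun j => f (t j)) (fun p => f (x p)) (fun p => f (y p))) = ⊤ := by
  rw [← map_generators, ← AlgHom.map_adjoin, hD, Algebra.map_top, AlgHom.range_eq_top]
  exact hf

theorem IsGWAPresentation.map (H : IsGWAPresentation.{u} π q h t x y s) (e : R ≃ₐ[k] R') :
    IsGWAPresentation.{u} π q h (fun j => e (t j)) (fun p => e (x p)) (fun p => e (y p)) (e s) where
  toGWARelations := H.toGWARelations.map e.toAlgHom
  commute_s r := by
    have := (H.commute_s (e.symm r)).map e
    rwa [e.apply_symm_apply] at this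
  adjoin_eq_top := adjoin_generators_map H.adjoin_eq_top e.toAlgHom e.surjective
  exists_algHom E _ _ t' x' y' s' h1 h2 := by
    obtain ⟨σ, a1, a2, a3, a4⟩ := H.exists_algHom E t' x' y' s' h1 h2
    exact ⟨σ.comp e.symm.toAlgHom, by simpa using a1, by simpa using a2, by simpa using a3,
      by simpa using a4⟩

/-- All the generators other than `x p` and `y p`. -/
def otherGenerators (p : P) (s : R) (t : J → R) (x y : P → R) :
    Option (J ⊕ ({p' // p' ≠ p} ⊕ {p' // p' ≠ p})) → R
  | none => s
  | some (.inl j) => t j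
  | some (.inr (.inl p')) => x p'
  | some (.inr (.inr p')) => y p'

open Classical in
/-- The scalars by which `x p` commutes with the generators other than `x p` and `y p`. -/
noncomputable def commutationScalar (π : P → J) (q : P → k) (p : P) :
    Option (J ⊕ ({p' // p' ≠ p} ⊕ {p' // p' ≠ p})) → k
  | some (.inl j) => if π p = j then q p else 1
  | _ => 1

theorem IsGWAPresentation.isWeylExtension (H : IsGWAPresentation.{u} π q h t x y s)
    (hq : ∀ p, q p ≠ 0) (p : P) :
    IsWeylExtension.{u} (otherGenerators p s t x y) (commutationScalar π q p)
      (some (.inl (π p))) (h p) (x p) (y p) where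
  c_ne_zero := by
    rintro (_ | j | p' | p') <;> simp only [commutationScalar]
    case some.inl => split_ifs <;> simp [hq]
    all_goals exact one_ne_zero
  x_mul := by
    rintro (_ | j | p' | p') <;> simp only [commutationScalar, otherGenerators]
    case some.inl =>
      split_ifs with hj
      · subst hj; exact H.x_t p
      · rw [one_smul]; exact H.x_t_of_ne p j hj
    all_goals rw [one_smul]
    · exact (H.commute_s _).symm
    · exact H.x_x p p' p'.2.symm
    · exact H.x_y_of_ne p p' p'.2.symm
  y_mul := by
    rintro (_ | j | p' | p') <;> simp only [commutationScalar, otherGenerators]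
    case some.inl =>
      split_ifs with hj
      · subst hj; exact H.y_t p
      · rw [inv_one, one_smul]; exact H.y_t_of_ne p j hj
    all_goals rw [inv_one, one_smul]
    · exact (H.commute_s _).symm
    · exact (H.x_y_of_ne p' p p'.2).symm
    · exact H.y_y p p' p'.2.symm
  xy := H.x_y p
  yx := by simpa [commutationScalar, otherGenerators] using H.y_x p
  adjoin_eq_top := by
    rw [eq_top_iff, ← H.adjoin_eq_top]
    refine Algebra.adjoin_mono (forall_mem_generators.mpr
      ⟨.inr (.inr ⟨none, rfl⟩), fun j => .inr (.inr ⟨some (.inl j), rfl⟩), fun p' => ?_,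
        fun p' => ?_⟩)
    · by_cases hp : p' = p
      · exact hp ▸ .inl rfl
      · exact .inr (.inr ⟨some (.inr (.inl ⟨p', hp⟩)), rfl⟩)
    · by_cases hp : p' = p
      · exact hp ▸ .inr (.inl rfl)
      · exact .inr (.inr ⟨some (.inr (.inr ⟨p', hp⟩)), rfl⟩)
  exists_algHom E _ _ ρ x' y' h1 h2 h3 h4 := by
    classical
    have hx : ∀ i, commutationScalar π q p i = 1 →
        Commute x' (ρ (otherGenerators p s t x y i)) := fun i hi => by
      have := h1 i
      rwa [hi, one_smul] at this
    have hy : ∀ i, commutationScalar π q p i = 1 →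
        Commute y' (ρ (otherGenerators p s t x y i)) := fun i hi => by
      have := h2 i
      rwa [hi, inv_one, one_smul] at this
    have hupd : ∀ (f : P → E) (a : E) (p'), p' ≠ p → Function.update f p a p' = f p' :=
      fun f a p' hp => Function.update_of_ne hp a f
    have Hρ := H.toGWARelations.map ρ
    have hcp : commutationScalar π q p (some (.inl (π p))) = q p := by simp [commutationScalar]
    have hcj : ∀ j, π p ≠ j → commutationScalar π q p (some (.inl j)) = 1 := fun j hj => by
      simp [commutationScalar, hj]
    have hrel : GWARelations π q h (fun j => ρ (t j)) (Function.update (fun p => ρ (x p)) p x')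
        (Function.update (fun p => ρ (y p)) p y') := by
      refine ⟨Hρ.t_t, fun p' => ?_, fun p' => ?_, fun p' j hj => ?_, fun p' j hj => ?_,
        fun p' => ?_, fun p' => ?_, fun a b hab => ?_, fun a b hab => ?_, fun a b hab => ?_⟩
      · by_cases hp : p' = p
        · subst hp; simpa [hcp, otherGenerators] using h1 (some (.inl (π p')))
        · simpa [hp] using Hρ.x_t p'
      · by_cases hp : p' = p
        · subst hp; simpa [hcp, otherGenerators] using h2 (some (.inl (π p')))
        · simpa [hp] using Hρ.y_t p'
      · by_cases hp : p' = p
        · subst hp; simpa [otherGenerators] using hx _ (hcj j hj)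
        · simpa [hp] using Hρ.x_t_of_ne p' j hj
      · by_cases hp : p' = p
        · subst hp; simpa [otherGenerators] using hy _ (hcj j hj)
        · simpa [hp] using Hρ.y_t_of_ne p' j hj
      · by_cases hp : p' = p
        · subst hp; simpa [otherGenerators] using h3
        · simpa [hp] using Hρ.x_y p'
      · by_cases hp : p' = p
        · subst hp; simpa [hcp, otherGenerators] using h4
        · simpa [hp] using Hρ.y_x p'
      · by_cases ha : a = p
        · subst ha
          simpa [otherGenerators, hab.symm] using hx (some (.inr (.inl ⟨b, hab.symm⟩))) rfl
        · by_cases hb : b = p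
          · subst hb
            simpa [otherGenerators, hab] using (hx (some (.inr (.inl ⟨a, hab⟩))) rfl).symm
          · simpa [ha, hb] using Hρ.x_x a b hab
      · by_cases ha : a = p
        · subst ha
          simpa [otherGenerators, hab.symm] using hy (some (.inr (.inr ⟨b, hab.symm⟩))) rfl
        · by_cases hb : b = p
          · subst hb
            simpa [otherGenerators, hab] using (hy (some (.inr (.inr ⟨a, hab⟩))) rfl).symm
          · simpa [ha, hb] using Hρ.y_y a b hab
      · by_cases ha : a = p
        · subst ha
          simpa [otherGenerators, hab.symm] using hx (some (.inr (.inr ⟨b, hab.symm⟩))) rfl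
        · by_cases hb : b = p
          · subst hb
            simpa [otherGenerators, hab] using (hy (some (.inr (.inl ⟨a, hab⟩))) rfl).symm
          · simpa [ha, hb] using Hρ.x_y_of_ne a b hab
    obtain ⟨σ, a1, a2, a3, a4⟩ := H.exists_algHom E _ _ _ (ρ s) hrel (by
      refine forall_mem_generators.mpr ⟨.refl _, fun j => (H.commute_s _).map ρ, fun p' => ?_,
        fun p' => ?_⟩
      · by_cases hp : p' = p
        · subst hp; simpa [otherGenerators] using (hx none rfl).symm
        · simpa [hp] using (H.commute_s _).map ρ
      · by_cases hp : p' = p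
        · subst hp; simpa [otherGenerators] using (hy none rfl).symm
        · simpa [hp] using (H.commute_s _).map ρ)
    refine ⟨σ, ?_, by simpa using a2 p, by simpa using a3 p⟩
    rintro (_ | j | p' | p')
    · exact a4
    · exact a1 j
    · simpa [otherGenerators, p'.2] using a2 p'
    · simpa [otherGenerators, p'.2] using a3 p'

end Presentation

section Nilpotence

universe u v

theorem GWARelations.separatesCenter_of_algebra {k : Type v} {Z B : Type u} {J P : Type*} [Field k]
    [CommRing Z] [Ring B] [Algebra k Z] [Algebra k B] [Algebra Z B] [IsScalarTower k Z B]
    (hinj : Function.Injective (algebraMap Z B))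
    (hZ : ∀ c : B, (∀ b, Commute c b) → c ∈ Set.range (algebraMap Z B))
    [Finite J] [Finite P] {π : P → J} {q : P → k} {h : P → k[X]} {t : J → B}
    {x y : P → B} {s : B} (H : GWARelations π q h t x y) (hs : ∀ b, Commute s b)
    (hD : Algebra.adjoin k (generators s t x y) = ⊤) (hq : ∀ p, q p ≠ 0) {N : ℕ} (hN : 0 < N)
    (hqN : ∀ p, q p ^ N = 1) : SeparatesCenter k B := by
  obtain ⟨S, hS, ht, hx, hy⟩ := H.exists_fg (Λ := Z) hN
    (fun j => hZ _ (H.commute_t_pow hs hD hqN j)) (fun p => hZ _ (H.commute_x_pow hs hD hqN p))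
    (fun p => hZ _ (H.commute_y_pow hs hD hq hqN p))
  have hST : S = ⊤ := by
    have h1 : Algebra.adjoin k (generators s t x y) ≤ S.restrictScalars k :=
      Algebra.adjoin_le (forall_mem_generators.mpr
        ⟨by obtain ⟨z, hz⟩ := hZ s hs; exact hz ▸ S.algebraMap_mem z, ht, hx, hy⟩)
    rw [hD] at h1
    exact eq_top_iff.mpr fun b _ => h1 Algebra.mem_top
  have : Module.Finite Z B := ⟨by rw [← Algebra.top_toSubmodule, ← hST]; exact hS⟩
  exact separatesCenter_of_finite hinj hZ

theorem GWARelations.separatesCenter {k : Type v} {B : Type u} {J P : Type*} [Field k] [Ring B]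
    [Algebra k B] [Finite J] [Finite P] {π : P → J} {q : P → k} {h : P → k[X]} {t : J → B}
    {x y : P → B} {s : B} (H : GWARelations π q h t x y) (hs : ∀ b, Commute s b)
    (hD : Algebra.adjoin k (generators s t x y) = ⊤) (hq : ∀ p, q p ≠ 0) {N : ℕ} (hN : 0 < N)
    (hqN : ∀ p, q p ^ N = 1) : SeparatesCenter k B := by
  let A : Algebra (Subalgebra.center k B) B := RingHom.toAlgebra'
    (Subalgebra.center k B).val.toRingHom fun c b => (Subalgebra.mem_center_iff.mp c.2 b).symm
  exact @separatesCenter_of_algebra k (Subalgebra.center k B) B J P _ _ _ _ _ A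
    (@IsScalarTower.of_algebraMap_eq k (Subalgebra.center k B) B _ _ _ _ A _ fun _ => rfl)
    Subtype.val_injective (fun c hc => ⟨⟨c, Subalgebra.mem_center_iff.mpr fun b => (hc b).symm⟩, rfl⟩)
    _ _ _ _ _ _ _ _ _ H hs hD hq _ hN hqN

variable {k : Type v} {B : Type u} {J P : Type*} [Field k] [Ring B] [Algebra k B] {π : P → J}
  {q : P → k} {h : P → k[X]} {t : J → B[X]} {x y : P → B[X]} {s : B[X]}
  (H : IsGWAPresentation.{u} π q h t x y s) (hq : ∀ p, q p ≠ 0) {N : ℕ} (hN : 0 < N)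
  (hqN : ∀ p, q p ^ N = 1)
include H hq hqN

include hN in
theorem IsGWAPresentation.separatesCenter [Finite J] [Finite P] : SeparatesCenter k B := by
  let f : B[X] →ₐ[k] B := eval₂AlgHom (AlgHom.id k B) 0 (fun _ => Commute.zero_right _)
  have hf : Function.Surjective f := fun b => ⟨C b, by simp [f]⟩
  refine (H.toGWARelations.map f).separatesCenter (s := f s) (fun b => ?_)
    (adjoin_generators_map H.adjoin_eq_top f hf) hq hN hqN
  obtain ⟨r, rfl⟩ := hf b
  exact (H.commute_s r).map f

variable (hB : SeparatesCenter k B) (hπ : Function.Surjective π) (hq1 : ∀ p, q p ≠ 1)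
  (hh : ∀ p, h p ≠ 0)
include hB hπ hq1 hh

theorem IsGWAPresentation.isNilpotent_coeff_t (j : J) :
    ∀ i ≠ 0, IsNilpotent ((t j ^ N).coeff i) := by
  intro i hi
  obtain ⟨p, rfl⟩ := hπ j
  refine isNilpotent_coeff_of_normal hB H.adjoin_eq_top (forall_mem_generators.mpr
    ⟨?_, fun j => ?_, fun p' => ?_, fun p' => ?_⟩) (hq1 p) (H.x_t p) (hh p) (H.x_y p)
    (H.commute_t_pow H.commute_s H.adjoin_eq_top hqN (π p)) ?_ hi
  · exact ⟨1, by rw [one_smul, (H.commute_s _).eq]⟩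
  · exact ⟨1, by rw [one_smul, (H.t_t _ _).eq]⟩
  · by_cases hp : π p' = π p
    · exact ⟨(q p')⁻¹, by rw [← hp, H.x_t, smul_smul, inv_mul_cancel₀ (hq p'), one_smul]⟩
    · exact ⟨1, by rw [one_smul, (H.x_t_of_ne p' _ hp).eq]⟩
  · by_cases hp : π p' = π p
    · exact ⟨q p', by rw [← hp, H.y_t, smul_smul, mul_inv_cancel₀ (hq p'), one_smul]⟩
    · exact ⟨1, by rw [one_smul, (H.y_t_of_ne p' _ hp).eq]⟩
  intro E _ _ ρ hρ
  have Hρ := H.toGWARelations.map ρ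
  have hxy : ∀ p', π p' = π p → Commute (ρ (x p')) (ρ (y p')) := fun p' hp => by
    rw [commute_iff_eq, Hρ.x_y, Hρ.y_x, hp, hρ, smul_zero]
  have key : ∀ z : B[X], (∀ g ∈ generators s t x y, Commute (ρ z) (ρ g)) →
      ∀ r, Commute (ρ z) (ρ r) := fun z => commute_map_of_adjoin_eq_top H.adjoin_eq_top ρ
  have hzero : ∀ {z : B[X]}, Commute (ρ z) (ρ (t (π p))) := by simp [hρ]
  refine forall_mem_generators.mpr ⟨.inl (H.commute_s _), fun j => .inl (H.t_t _ _), fun p' => ?_,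
    fun p' => ?_⟩
  · by_cases hp : π p' = π p
    · refine .inr (key _ (forall_mem_generators.mpr ⟨((H.commute_s _).map ρ).symm, fun j => ?_,
        fun a => ?_, fun a => ?_⟩))
      · by_cases hj : π p' = j
        · rw [← hj, hp]; exact hzero
        · exact Hρ.x_t_of_ne p' j hj
      · by_cases ha : p' = a
        · rw [ha]
        · exact Hρ.x_x p' a ha
      · by_cases ha : p' = a
        · exact ha ▸ hxy p' hp
        · exact Hρ.x_y_of_ne p' a ha
    · exact .inl (H.x_t_of_ne p' _ hp)
  · by_cases hp : π p' = π p
    · refine .inr (key _ (forall_mem_generators.mpr ⟨((H.commute_s _).map ρ).symm, fun j => ?_,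
        fun a => ?_, fun a => ?_⟩))
      · by_cases hj : π p' = j
        · rw [← hj, hp]; exact hzero
        · exact Hρ.y_t_of_ne p' j hj
      · by_cases ha : p' = a
        · exact ha ▸ (hxy p' hp).symm
        · exact (Hρ.x_y_of_ne a p' (Ne.symm ha)).symm
      · by_cases ha : p' = a
        · rw [ha]
        · exact Hρ.y_y p' a ha
    · exact .inl (H.y_t_of_ne p' _ hp)

include hN

theorem IsGWAPresentation.isNilpotent_coeff_x (p : P) :
    ∀ i ≠ 0, IsNilpotent ((x p ^ N).coeff i) :=
  (H.isWeylExtension hq p).isNilpotent_coeff_pow hB hN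
    (H.commute_x_pow H.commute_s H.adjoin_eq_top hqN p)
    (H.commute_y_pow H.commute_s H.adjoin_eq_top hq hqN p) hN
    (H.commute_t_pow H.commute_s H.adjoin_eq_top hqN (π p))
    (H.isNilpotent_coeff_t hq hqN hB hπ hq1 hh (π p))

theorem IsGWAPresentation.isNilpotent_coeff_y (p : P) :
    ∀ i ≠ 0, IsNilpotent ((y p ^ N).coeff i) :=
  (H.isWeylExtension hq p).swap.isNilpotent_coeff_pow hB hN
    (H.commute_y_pow H.commute_s H.adjoin_eq_top hq hqN p)
    (H.commute_x_pow H.commute_s H.adjoin_eq_top hqN p) hN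
    (H.commute_t_pow H.commute_s H.adjoin_eq_top hqN (π p))
    (H.isNilpotent_coeff_t hq hqN hB hπ hq1 hh (π p))

theorem IsGWAPresentation.isNilpotent_coeff_of_mem_adjoin [Finite J] [Finite P] {z : B[X]}
    (hz : ∀ r, Commute z r)
    (hzm : z ∈ Algebra.adjoin k (Set.range t ∪ (Set.range x ∪ Set.range y))) :
    ∀ i ≠ 0, IsNilpotent (z.coeff i) := by
  refine isNilpotent_coeff_of_natDegree_eq_zero hB hz fun K _ _ _ d _ ρ hρ f hf => ?_
  set σ := specialize ρ (CAlgHom : K →ₐ[k] K[X]) X with hσ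
  have hspec : ∀ {w : B[X]} {g : K[X]}, Represents ρ w g → σ w = Matrix.scalar _ g :=
    fun hg => specialize_pow_eq_scalar (AlgHom.id k K[X]) hg
  have hconst : ∀ w : B[X], (∀ r, Commute (w ^ N) r) → (∀ i ≠ 0, IsNilpotent ((w ^ N).coeff i)) →
      σ w ^ N ∈ Set.range (algebraMap K (Matrix (Fin d) (Fin d) K[X])) := by
    intro w hw hwn
    obtain ⟨g, hg⟩ := exists_polynomial_of_central ρ hρ hw
    refine ⟨g.coeff 0, ?_⟩
    rw [← map_pow, hspec hg, Represents.eq_C_of_isNilpotent hg hwn, coeff_C_zero]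
    ext i j
    simp [Matrix.algebraMap_matrix_apply, Matrix.diagonal_apply]
  obtain ⟨S, hS, ht, hx, hy⟩ := (H.toGWARelations.map σ).exists_fg (Λ := K) hN
    (fun j => hconst _ (H.commute_t_pow H.commute_s H.adjoin_eq_top hqN j)
      (H.isNilpotent_coeff_t hq hqN hB hπ hq1 hh j))
    (fun p => hconst _ (H.commute_x_pow H.commute_s H.adjoin_eq_top hqN p)
      (H.isNilpotent_coeff_x hq hN hqN hB hπ hq1 hh p))
    (fun p => hconst _ (H.commute_y_pow H.commute_s H.adjoin_eq_top hq hqN p)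
      (H.isNilpotent_coeff_y hq hN hqN hB hπ hq1 hh p))
  refine natDegree_eq_zero_of_mem_fg S hS (f := f) ?_
  rw [← hspec hf]
  have h1 : Algebra.adjoin k (Set.range t ∪ (Set.range x ∪ Set.range y)) ≤
      (S.restrictScalars k).comap σ := by
    refine Algebra.adjoin_le ?_
    rintro _ (⟨j, rfl⟩ | ⟨p, rfl⟩ | ⟨p, rfl⟩)
    · exact ht j
    · exact hx p
    · exact hy p
  exact h1 hzm

end Nilpotence

section Cancellation

theorem isNilpotent_derivative_map_sub {R S : Type*} [CommRing R] [CommRing S]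
    (φ : R[X] →+* S[X]) (hφ : ∀ c, ∀ i ≠ 0, IsNilpotent ((φ (C c)).coeff i)) (f : R[X]) :
    IsNilpotent (derivative (φ f) - φ (derivative f) * derivative (φ X)) := by
  have hC : ∀ c, IsNilpotent (derivative (φ (C c))) := fun c =>
    Polynomial.isNilpotent_iff.mpr fun i => by
      rw [coeff_derivative]
      exact (Commute.all _ _).isNilpotent_mul_right (hφ c _ i.succ_ne_zero)
  induction f using Polynomial.induction_on' with
  | add f g hf hg =>
    simp only [map_add, add_mul]
    rw [add_sub_add_comm]
    exact (Commute.all _ _).isNilpotent_add hf hg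
  | monomial n c =>
    rw [← C_mul_X_pow_eq_monomial, derivative_C_mul_X_pow]
    simp only [map_mul, map_pow, derivative_mul, derivative_pow, map_natCast]
    have h := (Commute.all (derivative (φ (C c))) (φ X ^ n)).isNilpotent_mul_right (hC c)
    have h1 : derivative (φ (C c)) * φ X ^ n + φ (C c) * (↑n * φ X ^ (n - 1) * derivative (φ X)) -
        φ (C c) * ↑n * φ X ^ (n - 1) * derivative (φ X) = derivative (φ (C c)) * φ X ^ n := by ring
    rwa [h1]

theorem isUnit_derivative_symm_X {R S : Type*} [CommRing R] [CommRing S]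
    (φ : R[X] ≃+* S[X]) (hφ : ∀ c, ∀ i ≠ 0, IsNilpotent ((φ (C c)).coeff i)) :
    IsUnit (derivative (φ.symm X)) := by
  have h := isNilpotent_derivative_map_sub φ.toRingHom hφ (φ.symm X)
  simp only [RingEquiv.toRingHom_eq_coe, RingHom.coe_coe, RingEquiv.apply_symm_apply,
    derivative_X] at h
  have h1 := h.isUnit_one_sub
  rw [sub_sub_cancel] at h1
  have h2 := (isUnit_of_mul_isUnit_left h1).map φ.symm
  rwa [RingEquiv.symm_apply_apply] at h2

/-- Over a `ℚ`-algebra, a polynomial whose derivative is invertible has a right inverse for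
composition. -/
theorem exists_comp_eq_X_of_isUnit_derivative {R : Type*} [CommRing R]
    (hR : ∀ n : ℕ, n ≠ 0 → IsUnit (n : R)) {p : R[X]} (hp : IsUnit (derivative p)) :
    ∃ q, p.comp q = X := by
  obtain ⟨h0, h1⟩ := isUnit_iff_coeff_isUnit_isNilpotent.mp hp
  simp only [coeff_derivative, zero_add, Nat.cast_zero, mul_one] at h0 h1
  obtain ⟨u, hu⟩ := h0
  set x : R[X] := C (↑u⁻¹ : R) * (X - C (p.coeff 0)) with hx
  have hg : IsNilpotent (p - C (p.coeff 0) - C (p.coeff 1) * X) := by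
    refine Polynomial.isNilpotent_iff.mpr fun i => ?_
    rcases i with _ | _ | i
    · simp
    · simp
    · have h2 := h1 (i + 1) i.succ_ne_zero
      obtain ⟨v, hv⟩ := hR (i + 1 + 1) (by omega)
      have : p.coeff (i + 1 + 1) * (v : R) * (↑v⁻¹ : R) = p.coeff (i + 1 + 1) := by
        rw [mul_assoc, Units.mul_inv, mul_one]
      simp only [coeff_sub, coeff_C_succ, coeff_C_mul, coeff_X, sub_zero]
      rw [if_neg (by omega), mul_zero, sub_zero, ← this, hv]
      push_cast at h2 ⊢
      exact (Commute.all _ _).isNilpotent_mul_right h2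
  have hev : ∀ q : R[X], aeval q (p.map C - C X : R[X][X]) = p.comp q - X := fun q => by
    simp [comp, aeval_def, Polynomial.eval₂_eq_eval_map]
  have hnil : IsNilpotent (aeval x (p.map C - C X : R[X][X])) := by
    rw [hev]
    have h2 := hg.map (compRingHom x)
    have h3 : C (p.coeff 1) * x = X - C (p.coeff 0) := by
      rw [hx, ← mul_assoc, ← C_mul, ← hu, Units.mul_inv, C_1, one_mul]
    rwa [coe_compRingHom_apply, sub_comp, sub_comp, C_comp, mul_comp, C_comp, X_comp, h3,
      sub_sub, add_sub_cancel] at h2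
  have hder : IsUnit (aeval x (derivative (p.map C - C X : R[X][X]))) := by
    rw [derivative_sub, derivative_C, sub_zero, derivative_map]
    exact (hp.map (mapRingHom C)).map (aeval x)
  obtain ⟨q, ⟨-, hq⟩, -⟩ := existsUnique_nilpotent_sub_and_aeval_eq_zero hnil hder
  exact ⟨q, by rwa [hev, sub_eq_zero] at hq⟩

theorem exists_comp_inverse_of_isUnit_derivative {R : Type*} [CommRing R]
    (hR : ∀ n : ℕ, n ≠ 0 → IsUnit (n : R)) {p : R[X]} (hp : IsUnit (derivative p)) :
    ∃ q, p.comp q = X ∧ q.comp p = X := by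
  obtain ⟨q, hq⟩ := exists_comp_eq_X_of_isUnit_derivative hR hp
  have h1 : IsUnit (derivative q) := by
    have := congrArg derivative hq
    rw [derivative_comp, derivative_X] at this
    exact IsUnit.of_mul_eq_one _ this
  obtain ⟨p', hcomp⟩ := exists_comp_eq_X_of_isUnit_derivative hR h1
  have : p' = p := by
    rw [← X_comp (p := p'), ← hq, comp_assoc, hcomp, comp_X]
  exact ⟨q, hq, this ▸ hcomp⟩

/-- The polynomial ring over the centre is the centre of the polynomial ring. -/
noncomputable def centerPolynomialEquiv (R : Type*) [Ring R] :
    (Subring.center R)[X] ≃+* Subring.center R[X] :=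
  RingEquiv.ofBijective ((mapRingHom (Subring.center R).subtype).codRestrict (Subring.center R[X])
    fun f => Subring.mem_center_iff.mpr fun g => by
      induction f using Polynomial.induction_on' with
      | add f f' hf hf' => rw [map_add, mul_add, add_mul, hf, hf']
      | monomial n c =>
        rw [coe_mapRingHom, map_monomial, ← C_mul_X_pow_eq_monomial]
        have h : Commute g (C ((Subring.center R).subtype c)) := ?_
        · exact h.mul_right (commute_X_pow g n).symm
        ext i
        rw [coeff_mul_C, coeff_C_mul]
        exact Subring.mem_center_iff.mp c.2 _)
    ⟨fun f g h => map_injective _ Subtype.val_injective (congrArg Subtype.val h), fun z => by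
      have hz : (z : R[X]) ∈ (mapRingHom (Subring.center R).subtype).range := by
        rw [mem_map_range]
        intro n
        exact ⟨⟨_, Subring.mem_center_iff.mpr fun b =>
          (commute_coeff (fun r => (Subring.mem_center_iff.mp z.2 r).symm) n b).symm.eq⟩, rfl⟩
      obtain ⟨f, hf⟩ := hz
      exact ⟨f, Subtype.ext hf⟩⟩

theorem coe_centerPolynomialEquiv {R : Type*} [Ring R] (f : (Subring.center R)[X]) :
    (centerPolynomialEquiv R f : R[X]) = f.map (Subring.center R).subtype := rfl

variable {k A B : Type*} [Field k] [Ring A] [Ring B] [Algebra k A] [Algebra k B]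

theorem nonempty_algEquiv_of_apply_X_eq_X (e : A[X] ≃ₐ[k] B[X]) (he : e X = X) :
    Nonempty (A ≃ₐ[k] B) := by
  let εA : A[X] →ₐ[k] A := eval₂AlgHom (AlgHom.id k A) 0 fun _ => Commute.zero_right _
  let εB : B[X] →ₐ[k] B := eval₂AlgHom (AlgHom.id k B) 0 fun _ => Commute.zero_right _
  have hA : (((εA.comp e.symm.toAlgHom).comp CAlgHom).comp εB) = εA.comp e.symm.toAlgHom :=
    algHom_ext' (by ext; simp [εB]) (by
      have hX : e.symm X = X := by rw [← he, e.symm_apply_apply]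
      simp [εA, εB, hX])
  have hB : (((εB.comp e.toAlgHom).comp CAlgHom).comp εA) = εB.comp e.toAlgHom :=
    algHom_ext' (by ext; simp [εA]) (by simp [εA, εB, he])
  refine ⟨AlgEquiv.ofAlgHom ((εB.comp e.toAlgHom).comp CAlgHom)
    ((εA.comp e.symm.toAlgHom).comp CAlgHom) ?_ ?_⟩
  · ext b
    simpa [εB] using DFunLike.congr_fun hB (e.symm (C b))
  · ext a
    simpa [εA] using DFunLike.congr_fun hA (e (C a))

/-- Substitution of a polynomial with central coefficients. -/
noncomputable def centralSubst (f : (Subring.center A)[X]) : A[X] →ₐ[k] A[X] :=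
  eval₂AlgHom CAlgHom (centerPolynomialEquiv A f)
    fun _ => Subring.mem_center_iff.mp (centerPolynomialEquiv A f).2 _

theorem centralSubst_X (f : (Subring.center A)[X]) :
    centralSubst (k := k) f X = f.map (Subring.center A).subtype := by
  simp [centralSubst, coe_centerPolynomialEquiv]

theorem centralSubst_C (f : (Subring.center A)[X]) (a : A) :
    centralSubst (k := k) f (C a) = C a :=
  eval₂_C _ _

theorem centralSubst_map (f g : (Subring.center A)[X]) :
    centralSubst (k := k) f (g.map (Subring.center A).subtype) =
      (g.comp f).map (Subring.center A).subtype := by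
  induction g using Polynomial.induction_on' with
  | add g g' hg hg' => rw [Polynomial.map_add, map_add, hg, hg', add_comp, Polynomial.map_add]
  | monomial n c =>
    rw [map_monomial, ← C_mul_X_pow_eq_monomial, map_mul, map_pow, centralSubst_C, centralSubst_X,
      ← C_mul_X_pow_eq_monomial, mul_comp, C_comp, X_pow_comp, Polynomial.map_mul, map_C,
      Polynomial.map_pow]

/-- If an isomorphism of polynomial rings sends the central constants to polynomials that are
constant up to nilpotents, then the coefficient rings are isomorphic. -/
theorem nonempty_algEquiv_of_isNilpotent_coeff [CharZero k] (e : A[X] ≃ₐ[k] B[X])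
    (he : ∀ c : A, (∀ a, Commute c a) → ∀ i ≠ 0, IsNilpotent ((e (C c)).coeff i)) :
    Nonempty (A ≃ₐ[k] B) := by
  let φ : (Subring.center A)[X] ≃+* (Subring.center B)[X] := (centerPolynomialEquiv A).trans
    ((Subring.centerCongr e.toRingEquiv).trans (centerPolynomialEquiv B).symm)
  have hφ : ∀ f, (φ f).map (Subring.center B).subtype = e (f.map (Subring.center A).subtype) :=
    fun f => by
      rw [← coe_centerPolynomialEquiv, ← coe_centerPolynomialEquiv]
      simp only [φ, RingEquiv.trans_apply, RingEquiv.apply_symm_apply]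
      rfl
  have hn : ∀ n : ℕ, n ≠ 0 → IsUnit (n : Subring.center A) := fun n hn => by
    have hu : algebraMap k A (n : k)⁻¹ ∈ Subring.center A :=
      Subring.mem_center_iff.mpr fun a => (Algebra.commutes _ a).symm
    refine IsUnit.of_mul_eq_one ⟨_, hu⟩ (Subtype.ext ?_)
    have : algebraMap k A (n : k) * algebraMap k A (n : k)⁻¹ = 1 := by
      rw [← map_mul, mul_inv_cancel₀ (Nat.cast_ne_zero.mpr hn), map_one]
    simpa using this
  obtain ⟨f, hf, hf'⟩ := exists_comp_inverse_of_isUnit_derivative hn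
    (isUnit_derivative_symm_X φ fun c i hi => by
      have h1 := he c (fun a => (Subring.mem_center_iff.mp c.2 a).symm) i hi
      have h2 := hφ (C c)
      rw [map_C] at h2
      change _ = e (C (c : A)) at h2
      rw [← h2, coeff_map] at h1
      exact (IsNilpotent.map_iff (f := (Subring.center B).subtype) Subtype.val_injective).mp h1)
  have hX : ∀ g g' : (Subring.center A)[X], g.comp g' = X →
      (centralSubst (k := k) g').comp (centralSubst g) = AlgHom.id k _ := fun g g' hg =>
    algHom_ext' (by ext; simp [centralSubst_C])
      (by rw [AlgHom.comp_apply, centralSubst_X, centralSubst_map, hg, map_X]; rfl)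
  refine nonempty_algEquiv_of_apply_X_eq_X
    ((AlgEquiv.ofAlgHom (centralSubst (φ.symm X)) (centralSubst f) (hX _ _ hf') (hX _ _ hf)).trans e)
    ?_
  rw [AlgEquiv.trans_apply, AlgEquiv.ofAlgHom_apply, centralSubst_X, ← hφ, φ.apply_symm_apply,
    map_X]

end Cancellation

section TensorProduct

universe u

/-- The ring structure whose underlying semiring is syntactically that of `RingQuot`. -/
noncomputable local instance gwaRing (k : Type*) [Field k] (m : ℕ) (q : Fin m → k)
    (h : Fin m → k[X]) : Ring (GWA k m q h) :=
  Algebra.semiringToRing k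

theorem gwaRelations (k : Type*) [Field k] (m : ℕ) (q : Fin m → k) (h : Fin m → k[X]) :
    GWARelations (fun _ => ()) q h (fun _ => (GWA.t : GWA k m q h)) GWA.x GWA.y where
  t_t _ _ := .refl _
  x_t p := by simpa [GWA.x, GWA.t] using RingQuot.mkAlgHom_rel k (GWARel.xt (h := h) p)
  y_t p := by simpa [GWA.y, GWA.t] using RingQuot.mkAlgHom_rel k (GWARel.yt (h := h) p)
  x_t_of_ne _ _ hj := absurd rfl hj
  y_t_of_ne _ _ hj := absurd rfl hj
  x_y p := by
    simpa [GWA.x, GWA.y, GWA.t, aeval_algHom_apply] using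
      RingQuot.mkAlgHom_rel k (GWARel.xy (q := q) (h := h) p)
  y_x p := by
    have := RingQuot.mkAlgHom_rel k (GWARel.yx (q := q) (h := h) p)
    rwa [map_mul, ← aeval_algHom_apply, map_smul] at this
  x_x p p' hp := by
    simpa [GWA.x, commute_iff_eq] using RingQuot.mkAlgHom_rel k (GWARel.xx (q := q) (h := h) p p' hp)
  y_y p p' hp := by
    simpa [GWA.y, commute_iff_eq] using RingQuot.mkAlgHom_rel k (GWARel.yy (q := q) (h := h) p p' hp)
  x_y_of_ne p p' hp := by
    simpa [GWA.x, GWA.y, commute_iff_eq] using RingQuot.mkAlgHom_rel k (GWARel.xyc (q := q) (h := h) p p' hp)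

theorem adjoin_gwa_eq_top (k : Type*) [Field k] (m : ℕ) (q : Fin m → k) (h : Fin m → k[X]) :
    Algebra.adjoin k (generators (GWA.t : GWA k m q h) (fun _ : Unit => GWA.t) GWA.x GWA.y) = ⊤ := by
  rw [eq_top_iff, ← (AlgHom.range_eq_top _).mpr (RingQuot.mkAlgHom_surjective k (GWARel k m q h)),
    ← Algebra.map_top, ← FreeAlgebra.adjoin_range_ι, AlgHom.map_adjoin]
  refine Algebra.adjoin_mono ?_
  rintro _ ⟨_, ⟨i | i | _, rfl⟩, rfl⟩
  · exact .inr (.inr (.inl ⟨i, rfl⟩))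
  · exact .inr (.inr (.inr ⟨i, rfl⟩))
  · exact .inl rfl

theorem GWARelations.exists_algHom_gwa {k E : Type*} [Field k] [Ring E] [Algebra k E] {m : ℕ}
    {q : Fin m → k} {h : Fin m → k[X]} {t : Unit → E} {x y : Fin m → E}
    (H : GWARelations (fun _ => ()) q h t x y) :
    ∃ σ : GWA k m q h →ₐ[k] E, σ GWA.t = t () ∧ (∀ i, σ (GWA.x i) = x i) ∧
      ∀ i, σ (GWA.y i) = y i := by
  let f : FreeAlgebra k (GWAGen m) →ₐ[k] E := FreeAlgebra.lift k fun
    | .x i => x i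
    | .y i => y i
    | .t => t ()
  have hx : ∀ i, f (FreeAlgebra.ι k (.x i)) = x i := fun i => FreeAlgebra.lift_ι_apply _ _
  have hy : ∀ i, f (FreeAlgebra.ι k (.y i)) = y i := fun i => FreeAlgebra.lift_ι_apply _ _
  have ht : f (FreeAlgebra.ι k .t) = t () := FreeAlgebra.lift_ι_apply _ _
  have hf : ∀ ⦃a b⦄, GWARel k m q h a b → f a = f b := by
    rintro _ _ (i | i | i | i | ⟨i, j, hij⟩ | ⟨i, j, hij⟩ | ⟨i, j, hij⟩) <;>
      simp only [map_mul, map_smul, ← aeval_algHom_apply, hx, hy, ht]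
    · exact H.x_t i
    · exact H.y_t i
    · exact H.x_y i
    · exact H.y_x i
    · exact H.x_x i j hij
    · exact H.y_y i j hij
    · exact H.x_y_of_ne i j hij
  exact ⟨RingQuot.liftAlgHom k ⟨f, hf⟩, by simp [GWA.t, ht], by simp [GWA.x, hx],
    by simp [GWA.y, hy]⟩

section PiTensorProduct

variable {k J : Type*} [Field k] [Fintype J] [DecidableEq J] {A : J → Type*} [∀ j, Ring (A j)]
  [∀ j, Algebra k (A j)]

omit [Fintype J] in
theorem commute_singleAlgHom {i j : J} (hij : i ≠ j) (a : A i) (b : A j) :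
    Commute (PiTensorProduct.singleAlgHom (R := k) (A := A) i a)
      (PiTensorProduct.singleAlgHom j b) :=
  Commute.tprod (Pi.mulSingle_commute hij a b)

theorem eq_top_of_singleAlgHom_mem (S : Subalgebra k (⨂[k] j, A j))
    (hS : ∀ j a, PiTensorProduct.singleAlgHom j a ∈ S) : S = ⊤ := by
  refine eq_top_iff.mpr fun z _ => ?_
  induction z using PiTensorProduct.induction_on with
  | smul_tprod r f =>
    refine S.smul_mem ?_ r
    exact Submonoid.pi_mem_of_mulSingle_mem
      (H := S.toSubmonoid.comap (PiTensorProduct.tprodMonoidHom k)) f fun j => hS j (f j)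
  | add a b ha hb => exact add_mem (ha trivial) (hb trivial)

theorem exists_algHom_piTensorProduct {E : Type*} [Ring E] [Algebra k E] (σ : ∀ j, A j →ₐ[k] E)
    (hσ : Pairwise fun i j => ∀ a b, Commute (σ i a) (σ j b)) :
    ∃ τ : (⨂[k] j, A j) →ₐ[k] E, ∀ j a, τ (PiTensorProduct.singleAlgHom j a) = σ j a := by
  let φ : (∀ j, A j) →* E := MonoidHom.noncommPiCoprod (fun j => (σ j : A j →* E)) hσ
  have hφ : ∀ j a, φ (Pi.mulSingle j a) = σ j a := fun j a =>
    MonoidHom.noncommPiCoprod_mulSingle _ _ _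
  have hu : ∀ (x : ∀ j, A j) (j : J) (a : A j),
      φ (Function.update x j a) = φ (Function.update x j 1) * σ j a := fun x j a => by
    rw [← hφ, ← map_mul]
    congr 1
    ext i
    by_cases hi : i = j
    · subst hi; simp
    · simp [hi]
  let f : MultilinearMap k A E :=
    { toFun := φ
      map_update_add' := fun {inst} x j a b => by
        rw [Subsingleton.elim inst, hu, hu _ _ a, hu _ _ b, map_add, mul_add]
      map_update_smul' := fun {inst} x j c a => by
        rw [Subsingleton.elim inst, hu, hu _ _ a, map_smul, mul_smul_comm] }
  refine ⟨PiTensorProduct.liftAlgHom f φ.map_one φ.map_mul, fun j a => ?_⟩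
  rw [← hφ]
  exact PiTensorProduct.lift.tprod _

end PiTensorProduct

variable (k : Type*) [Field k] {J : Type*} [Fintype J] [DecidableEq J] (m : J → ℕ)
  (q : ∀ j, Fin (m j) → k) (h : ∀ j, Fin (m j) → k[X])

omit [Fintype J] in
theorem gwaRelations_piTensorProduct :
    GWARelations (R := ⨂[k] j, GWA k (m j) (q j) (h j)) (P := Σ j, Fin (m j)) Sigma.fst
      (fun p => q p.1 p.2) (fun p => h p.1 p.2)
      (fun j => PiTensorProduct.singleAlgHom j GWA.t)
      (fun p => PiTensorProduct.singleAlgHom p.1 (GWA.x p.2))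
      (fun p => PiTensorProduct.singleAlgHom p.1 (GWA.y p.2)) := by
  have H : ∀ j, _ := fun j => (gwaRelations k (m j) (q j) (h j)).map
    (PiTensorProduct.singleAlgHom (R := k) (A := fun j => GWA k (m j) (q j) (h j)) j)
  refine ⟨fun i j => ?_, fun p => (H p.1).x_t p.2, fun p => (H p.1).y_t p.2,
    fun p j hj => commute_singleAlgHom hj _ _, fun p j hj => commute_singleAlgHom hj _ _,
    fun p => (H p.1).x_y p.2, fun p => (H p.1).y_x p.2, fun ⟨j, i⟩ ⟨j', i'⟩ hp => ?_,
    fun ⟨j, i⟩ ⟨j', i'⟩ hp => ?_, fun ⟨j, i⟩ ⟨j', i'⟩ hp => ?_⟩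
  · by_cases hij : i = j
    · rw [hij]
      exact .refl _
    · exact commute_singleAlgHom hij _ _
  all_goals
    by_cases hj : j = j'
    · subst hj
      have hi : i ≠ i' := fun hi => hp (hi ▸ rfl)
      first
      | exact (H j).x_x i i' hi
      | exact (H j).y_y i i' hi
      | exact (H j).x_y_of_ne i i' hi
    · exact commute_singleAlgHom hj _ _

theorem adjoin_piTensorProduct_eq_top :
    Algebra.adjoin k ((Set.range fun j => PiTensorProduct.singleAlgHom (R := k)
        (A := fun j => GWA k (m j) (q j) (h j)) j GWA.t) ∪
      ((Set.range fun p : Σ j, Fin (m j) =>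
          PiTensorProduct.singleAlgHom (R := k) p.1 (GWA.x p.2)) ∪
        Set.range fun p : Σ j, Fin (m j) =>
          PiTensorProduct.singleAlgHom (R := k) p.1 (GWA.y p.2))) = ⊤ := by
  refine eq_top_of_singleAlgHom_mem _ fun j a => ?_
  have ha : a ∈ (⊤ : Subalgebra k _) := trivial
  rw [← adjoin_gwa_eq_top] at ha
  have := (AlgHom.map_adjoin (PiTensorProduct.singleAlgHom (R := k)
    (A := fun j => GWA k (m j) (q j) (h j)) j) _).le (Subalgebra.mem_map.mpr ⟨a, ha, rfl⟩)
  refine Algebra.adjoin_mono ?_ this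
  rintro _ ⟨g, hg, rfl⟩
  revert g
  rw [forall_mem_generators]
  exact ⟨.inl ⟨j, rfl⟩, fun _ => .inl ⟨j, rfl⟩, fun i => .inr (.inl ⟨⟨j, i⟩, rfl⟩),
    fun i => .inr (.inr ⟨⟨j, i⟩, rfl⟩)⟩

theorem isGWAPresentation_polynomial_piTensorProduct :
    IsGWAPresentation.{u} (R := (⨂[k] j, GWA k (m j) (q j) (h j))[X]) (P := Σ j, Fin (m j))
      Sigma.fst (fun p => q p.1 p.2) (fun p => h p.1 p.2)
      (fun j => C (PiTensorProduct.singleAlgHom (R := k) j GWA.t))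
      (fun p => C (PiTensorProduct.singleAlgHom (R := k) p.1 (GWA.x p.2)))
      (fun p => C (PiTensorProduct.singleAlgHom (R := k) p.1 (GWA.y p.2))) X where
  toGWARelations := (gwaRelations_piTensorProduct k m q h).map CAlgHom
  commute_s r := (commute_X r)
  adjoin_eq_top := by
    refine eq_top_iff.mpr fun f _ => ?_
    have hC : ∀ a : ⨂[k] j, GWA k (m j) (q j) (h j), C a ∈ Algebra.adjoin k (generators
        (X : (⨂[k] j, GWA k (m j) (q j) (h j))[X])
        (fun j => C (PiTensorProduct.singleAlgHom (R := k) j GWA.t))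
        (fun p : Σ j, Fin (m j) => C (PiTensorProduct.singleAlgHom (R := k) p.1 (GWA.x p.2)))
        (fun p => C (PiTensorProduct.singleAlgHom (R := k) p.1 (GWA.y p.2)))) := fun a => by
      have ha : a ∈ (⊤ : Subalgebra k _) := trivial
      rw [← adjoin_piTensorProduct_eq_top k m q h] at ha
      have := (AlgHom.map_adjoin CAlgHom _).le (Subalgebra.mem_map.mpr ⟨a, ha, rfl⟩)
      refine Algebra.adjoin_mono ?_ this
      rw [Set.image_union, Set.image_union, ← Set.range_comp, ← Set.range_comp, ← Set.range_comp]
      exact Set.subset_insert _ _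
    induction f using Polynomial.induction_on' with
    | add f g hf hg => exact add_mem (hf trivial) (hg trivial)
    | monomial n a =>
      rw [← C_mul_X_pow_eq_monomial]
      exact mul_mem (hC a) (pow_mem (Algebra.subset_adjoin (.inl rfl)) n)
  exists_algHom E _ _ t' x' y' s' H hs := by
    have hj : ∀ j, GWARelations (fun _ => ()) (q j) (h j) (fun _ => t' j)
        (fun i => x' ⟨j, i⟩) (fun i => y' ⟨j, i⟩) := fun j => by
      have hne : ∀ i i' : Fin (m j), i ≠ i' → (⟨j, i⟩ : Σ j, Fin (m j)) ≠ ⟨j, i'⟩ :=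
        fun i i' hi he => hi (by simpa using he)
      exact ⟨fun _ _ => .refl _, fun i => H.x_t ⟨j, i⟩, fun i => H.y_t ⟨j, i⟩,
        fun _ _ hj => absurd rfl hj, fun _ _ hj => absurd rfl hj, fun i => H.x_y ⟨j, i⟩,
        fun i => H.y_x ⟨j, i⟩, fun i i' hi => H.x_x _ _ (hne i i' hi),
        fun i i' hi => H.y_y _ _ (hne i i' hi), fun i i' hi => H.x_y_of_ne _ _ (hne i i' hi)⟩
    choose σ ht hx hy using fun j => (hj j).exists_algHom_gwa
    have hcomm : ∀ j (z : E), Commute z (t' j) → (∀ i, Commute z (x' ⟨j, i⟩)) →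
        (∀ i, Commute z (y' ⟨j, i⟩)) → ∀ a, Commute z (σ j a) := fun j z h1 h2 h3 a => by
      refine commute_map_of_adjoin_eq_top (adjoin_gwa_eq_top k (m j) (q j) (h j)) (σ j) ?_ a
      rw [forall_mem_generators]
      simpa only [ht, hx, hy] using ⟨h1, fun _ => h1, h2, h3⟩
    have hσ : Pairwise fun i j => ∀ a b, Commute (σ i a) (σ j b) := fun i j hij a b => by
      have hne : ∀ a b, (⟨i, a⟩ : Σ j, Fin (m j)) ≠ ⟨j, b⟩ := fun a b he =>
        hij (congrArg Sigma.fst he)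
      refine hcomm j _ (hcomm i _ (H.t_t _ _) ?_ ?_ a).symm ?_ ?_ b
      · exact fun l => (H.x_t_of_ne ⟨i, l⟩ j hij).symm
      · exact fun l => (H.y_t_of_ne ⟨i, l⟩ j hij).symm
      · exact fun l => (hcomm i _ (H.x_t_of_ne ⟨j, l⟩ i hij.symm)
          (fun l' => H.x_x _ _ (hne l' l).symm) (fun l' => H.x_y_of_ne _ _ (hne l' l).symm) a).symm
      · exact fun l => (hcomm i _ (H.y_t_of_ne ⟨j, l⟩ i hij.symm)
          (fun l' => (H.x_y_of_ne _ _ (hne l' l)).symm) (fun l' => H.y_y _ _ (hne l' l).symm) a).symm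
    obtain ⟨τ, hτ⟩ := exists_algHom_piTensorProduct σ hσ
    rw [forall_mem_generators] at hs
    have hs' : ∀ a, Commute (τ a) s' := by
      have := eq_top_of_singleAlgHom_mem ((Subalgebra.centralizer k {s'}).comap τ) fun j a => by
        rw [Subalgebra.mem_comap, hτ, Subalgebra.mem_centralizer_iff]
        rintro z hz
        rw [Set.mem_singleton_iff.mp hz]
        exact hcomm j s' (hs.2.1 j) (fun i => hs.2.2.1 ⟨j, i⟩) (fun i => hs.2.2.2 ⟨j, i⟩) a
      intro a
      have ha : a ∈ (⊤ : Subalgebra k _) := trivial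
      rw [← this, Subalgebra.mem_comap, Subalgebra.mem_centralizer_iff] at ha
      exact (ha s' rfl).symm
    refine ⟨eval₂AlgHom τ s' hs', fun j => ?_, fun p => ?_, fun p => ?_, eval₂_X _ _⟩
    · exact (eval₂_C _ _).trans ((hτ _ _).trans (ht j))
    · exact (eval₂_C _ _).trans ((hτ _ _).trans (hx _ _))
    · exact (eval₂_C _ _).trans ((hτ _ _).trans (hy _ _))

end TensorProduct

end QuantumGWA

/-- Theorem 6.6(2) / 0.8(2). Assume `char k = 0`.  Let
`W⁽¹⁾, …, W⁽ʳ⁾` be quantum GWAs (of degrees `m₁, …, m_r`) such that in each factor every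
`q`-parameter is a root of unity of multiplicative order `≥ 2`, these orders are pairwise
coprime, and every `h`-parameter is nonconstant.  Then the tensor product
`A = W⁽¹⁾ ⊗ₖ ⋯ ⊗ₖ W⁽ʳ⁾` is cancellative: `A[s] ≅ B[s]` implies `A ≅ B` for every
`k`-algebra `B`. -/
theorem tensor_product_of_quantum_GWAs_cancellative
    (k : Type*) [Field k] [CharZero k] (r : ℕ)
    (m : Fin r → ℕ) (hm : ∀ j, 1 ≤ m j)
    (q : ∀ j : Fin r, Fin (m j) → k) (h : ∀ j : Fin r, Fin (m j) → Polynomial k)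
    (hord : ∀ j i, 2 ≤ orderOf (q j i))
    (hcop : ∀ j, ∀ i i', i ≠ i' → Nat.Coprime (orderOf (q j i)) (orderOf (q j i')))
    (hh : ∀ j i, 1 ≤ (h j i).natDegree)
    (B : Type*) [Ring B] [Algebra k B]
    (hiso : Nonempty
      (Polynomial (⨂[k] j : Fin r, GWA k (m j) (q j) (h j)) ≃ₐ[k] Polynomial B)) :
    Nonempty ((⨂[k] j : Fin r, GWA k (m j) (q j) (h j)) ≃ₐ[k] B) := by
  obtain ⟨e⟩ := hiso
  let _ := fun j => QuantumGWA.gwaRing k (m j) (q j) (h j)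
  have H := (QuantumGWA.isGWAPresentation_polynomial_piTensorProduct k m q h).map e
  have hq : ∀ p : Σ j, Fin (m j), q p.1 p.2 ≠ 0 := fun p hp => by
    have := pow_orderOf_eq_one (q p.1 p.2)
    rw [hp, zero_pow (by have := hord p.1 p.2; rw [hp] at this; lia)] at this
    exact zero_ne_one this
  have hq1 : ∀ p : Σ j, Fin (m j), q p.1 p.2 ≠ 1 := fun p hp => by
    have := hord p.1 p.2
    rw [hp, orderOf_one] at this
    lia
  have hh0 : ∀ p : Σ j, Fin (m j), h p.1 p.2 ≠ 0 := fun p hp => by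
    have := hh p.1 p.2
    rw [hp, natDegree_zero] at this
    lia
  have hN : 0 < ∏ p : Σ j, Fin (m j), orderOf (q p.1 p.2) :=
    Finset.prod_pos fun p _ => two_pos.trans_le (hord p.1 p.2)
  have hqN : ∀ p : Σ j, Fin (m j),
      q p.1 p.2 ^ (∏ p : Σ j, Fin (m j), orderOf (q p.1 p.2)) = 1 := fun p =>
    orderOf_dvd_iff_pow_eq_one.mp
      (Finset.dvd_prod_of_mem (fun p : Σ j, Fin (m j) => orderOf (q p.1 p.2)) (Finset.mem_univ p))
  have hπ : Function.Surjective (Sigma.fst : (Σ j, Fin (m j)) → Fin r) := fun j =>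
    ⟨⟨j, ⟨0, hm j⟩⟩, rfl⟩
  refine QuantumGWA.nonempty_algEquiv_of_isNilpotent_coeff e fun c hc => ?_
  refine H.isNilpotent_coeff_of_mem_adjoin hq hN hqN (H.separatesCenter hq hN hqN) hπ hq1 hh0
    (fun b => ?_) ?_
  · have hC : ∀ f, Commute (C c) f := fun f => by
      induction f using Polynomial.induction_on' with
      | add f g hf hg => exact hf.add_right hg
      | monomial n a =>
        rw [← C_mul_X_pow_eq_monomial]
        exact ((hc a).map C).mul_right (commute_X_pow _ _).symm
    simpa using (hC (e.symm b)).map e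
  · have hc : c ∈ (⊤ : Subalgebra k _) := trivial
    rw [← QuantumGWA.adjoin_piTensorProduct_eq_top k m q h] at hc
    have := (AlgHom.map_adjoin (e.toAlgHom.comp CAlgHom) _).le
      (Subalgebra.mem_map.mpr ⟨c, hc, rfl⟩)
    refine Algebra.adjoin_mono ?_ this
    rw [Set.image_union, Set.image_union, ← Set.range_comp, ← Set.range_comp, ← Set.range_comp]
    rfl
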